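/- arXiv:2402.09117 — 4 statements merged into one kernel-verified Lean document; each statement's English description precedes it below -/
import Mathlib

section
/- For the Bernoulli channel B and every λ₁, λ₂ > 0 with λ₁ + λ₂ < 1, the maximal deterministic identification code sizes satisfy 1/4 ≤ liminf_{n→∞} (1/(n log₂ n)) · log₂ N_DI(n,λ₁,λ₂) and limsup_{n→∞} (1/(n log₂ n)) · log₂ N_DI(n,λ₁,λ₂) ≤ 1/2. -/
open Real Filter

namespace Bern

/-- The Bernoulli output distribution `B_x` on `{0,1} ≅ Bool`: `B_x(1) = x`, `B_x(0) = 1−x`. -/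
noncomputable def bern (x : ℝ) : Bool → ℝ := fun y => if y then x else 1 - x

/-- Product Bernoulli distribution `B_{x^n}` on `{0,1}^n`. -/
noncomputable def bprod {n : ℕ} (u : Fin n → ℝ) (y : Fin n → Bool) : ℝ :=
  ∏ i, bern (u i) (y i)

/-- Probability of a set of output words under `B_{x^n}`. -/
noncomputable def bprob {n : ℕ} (u : Fin n → ℝ) (E : Finset (Fin n → Bool)) : ℝ :=
  ∑ y ∈ E, bprod u y

/-- An `(n,N,λ₁,λ₂)`-deterministic identification code for the Bernoulli channel restricted
to input letters in `S ⊆ [0,1]`. -/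
def bernCode (S : Set ℝ) (n N : ℕ) (l1 l2 : ℝ) : Prop :=
  ∃ (u : Fin N → Fin n → ℝ) (E : Fin N → Finset (Fin n → Bool)),
    (∀ j i, u j i ∈ S) ∧
    (∀ j, 1 - l1 ≤ bprob (u j) (E j)) ∧
    (∀ j k, j ≠ k → bprob (u j) (E k) ≤ l2)

end Bern

open Bern

namespace Bern

lemma bern_nonneg {x : ℝ} (hx : x ∈ Set.Icc (0:ℝ) 1) (b : Bool) : 0 ≤ bern x b := by
  unfold bern; split_ifs <;> linarith [hx.1, hx.2]

lemma bprod_nonneg {n : ℕ} {u : Fin n → ℝ} (hu : ∀ i, u i ∈ Set.Icc (0:ℝ) 1)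
    (y : Fin n → Bool) : 0 ≤ bprod u y :=
  Finset.prod_nonneg fun i _ => bern_nonneg (hu i) _

/-- Sums of products over words factorize. -/
lemma sum_prod_bool {n : ℕ} (f : Fin n → Bool → ℝ) :
    ∑ y : Fin n → Bool, ∏ i, f i (y i) = ∏ i, (f i true + f i false) := by
  have h := Finset.prod_univ_sum (fun _ : Fin n => (Finset.univ : Finset Bool)) f
  rw [Fintype.piFinset_univ] at h
  rw [← h]
  simp

lemma bprod_sum {n : ℕ} (u : Fin n → ℝ) : ∑ y, bprod u y = 1 := by
  unfold bprod
  rw [sum_prod_bool (fun i => bern (u i))]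
  simp [bern]

lemma bprob_compl {n : ℕ} (u : Fin n → ℝ) (E : Finset (Fin n → Bool)) :
    bprob u E + bprob u Eᶜ = 1 := by
  unfold bprob
  rw [Finset.sum_add_sum_compl, bprod_sum]

/-- The indicator of a bit. -/
noncomputable def bit (b : Bool) : ℝ := if b then 1 else 0

lemma exp_quad {x : ℝ} (hx : |x| ≤ 1) : Real.exp x ≤ 1 + x + x ^ 2 := by
  have := Real.abs_exp_sub_one_sub_id_le hx
  linarith [le_abs_self (Real.exp x - 1 - x)]

lemma mgf_letter {x a s : ℝ} (hx : x ∈ Set.Icc (0:ℝ) 1) (ha : |a| ≤ 1) (hs0 : 0 ≤ s)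
    (hs : s ≤ 1) :
    bern x true * Real.exp (s * (a * (bit true - x))) +
      bern x false * Real.exp (s * (a * (bit false - x))) ≤ Real.exp (s ^ 2) := by
  obtain ⟨h0, h1⟩ := hx
  have ha2 : a ^ 2 ≤ 1 := by rw [sq_le_one_iff_abs_le_one]; exact ha
  have hsa : |s * a| ≤ 1 := by
    rw [abs_mul, abs_of_nonneg hs0]
    nlinarith [abs_nonneg a]
  have e1 : |s * (a * (1 - x))| ≤ 1 := by
    rw [← mul_assoc, abs_mul, abs_of_nonneg (by linarith : 0 ≤ 1 - x)]
    nlinarith [abs_nonneg (s * a)]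
  have e2 : |s * (a * (0 - x))| ≤ 1 := by
    rw [← mul_assoc, abs_mul, zero_sub, abs_neg, abs_of_nonneg h0]
    nlinarith [abs_nonneg (s * a)]
  have q1 := exp_quad e1
  have q2 := exp_quad e2
  have q3 := Real.add_one_le_exp (s ^ 2)
  simp only [bern, bit, if_true, Bool.false_eq_true, if_false]
  have m1 := mul_le_mul_of_nonneg_left q1 h0
  have m2 := mul_le_mul_of_nonneg_left q2 (by linarith : 0 ≤ 1 - x)
  have hv : x * (1 - x) ≤ 1 := by nlinarith
  have hv0 : 0 ≤ x * (1 - x) := mul_nonneg h0 (by linarith)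
  have : s ^ 2 * a ^ 2 * (x * (1 - x)) ≤ s ^ 2 := by
    have : a ^ 2 * (x * (1 - x)) ≤ 1 := by nlinarith [sq_nonneg a]
    nlinarith [sq_nonneg s]
  nlinarith

lemma mgf {n : ℕ} {u a : Fin n → ℝ} {s : ℝ} (hu : ∀ i, u i ∈ Set.Icc (0:ℝ) 1)
    (ha : ∀ i, |a i| ≤ 1) (hs0 : 0 ≤ s) (hs : s ≤ 1) :
    ∑ y, bprod u y * Real.exp (s * ∑ i, a i * (bit (y i) - u i)) ≤ Real.exp (n * s ^ 2) := by
  have : ∀ y : Fin n → Bool, bprod u y * Real.exp (s * ∑ i, a i * (bit (y i) - u i)) =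
      ∏ i, (fun (i : Fin n) (b : Bool) =>
        bern (u i) b * Real.exp (s * (a i * (bit b - u i)))) i (y i) := by
    intro y
    rw [Finset.mul_sum, Real.exp_sum, bprod, ← Finset.prod_mul_distrib]
  rw [Finset.sum_congr rfl (fun y _ => this y),
    sum_prod_bool (fun (i : Fin n) (b : Bool) =>
      bern (u i) b * Real.exp (s * (a i * (bit b - u i))))]
  calc _ ≤ ∏ i : Fin n, Real.exp (s ^ 2) := by
        apply Finset.prod_le_prod
        · intro i _
          exact add_nonneg (mul_nonneg (bern_nonneg (hu i) _) (Real.exp_pos _).le)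
            (mul_nonneg (bern_nonneg (hu i) _) (Real.exp_pos _).le)
        · intro i _
          exact mgf_letter (hu i) (ha i) hs0 hs
    _ = _ := by
        rw [Finset.prod_const, ← Real.exp_nat_mul]; simp

lemma chernoff {n : ℕ} {u a : Fin n → ℝ} {s t : ℝ} (hu : ∀ i, u i ∈ Set.Icc (0:ℝ) 1)
    (ha : ∀ i, |a i| ≤ 1) (hs0 : 0 ≤ s) (hs : s ≤ 1) (E : Finset (Fin n → Bool))
    (hE : ∀ y ∈ E, t ≤ ∑ i, a i * (bit (y i) - u i)) :
    bprob u E ≤ Real.exp (n * s ^ 2 - s * t) := by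
  have h := mgf hu ha hs0 hs
  have h2 : bprob u E * Real.exp (s * t) ≤
      ∑ y, bprod u y * Real.exp (s * ∑ i, a i * (bit (y i) - u i)) := by
    unfold bprob
    rw [Finset.sum_mul]
    calc _ ≤ ∑ y ∈ E, bprod u y * Real.exp (s * ∑ i, a i * (bit (y i) - u i)) := by
          apply Finset.sum_le_sum
          intro y hy
          apply mul_le_mul_of_nonneg_left _ (bprod_nonneg hu y)
          apply Real.exp_le_exp.2
          exact mul_le_mul_of_nonneg_left (hE y hy) hs0
      _ ≤ _ := by
          apply Finset.sum_le_sum_of_subset_of_nonneg (Finset.subset_univ _)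
          intro y _ _
          exact mul_nonneg (bprod_nonneg hu y) (Real.exp_pos _).le
  rw [Real.exp_sub, le_div_iff₀ (Real.exp_pos _)]
  exact h2.trans h

/-- Chernoff with deviation `κ √n`. -/
lemma chernoff_sqrt {n : ℕ} (hn : 1 ≤ n) {u a : Fin n → ℝ} {κ : ℝ}
    (hu : ∀ i, u i ∈ Set.Icc (0:ℝ) 1)
    (ha : ∀ i, |a i| ≤ 1) (E : Finset (Fin n → Bool))
    (hE : ∀ y ∈ E, κ * √n ≤ ∑ i, a i * (bit (y i) - u i)) :
    bprob u E ≤ Real.exp (1 - κ) := by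
  have hn' : (1:ℝ) ≤ n := by exact_mod_cast hn
  have hs : 1 ≤ √(n:ℝ) := Real.one_le_sqrt.2 hn'
  have hsp : 0 < √(n:ℝ) := by linarith
  have := chernoff hu ha (s := 1 / √n) (by positivity) (by rw [div_le_one hsp]; exact hs) E hE
  convert this using 2
  have : √(n:ℝ) ^ 2 = n := Real.sq_sqrt (by linarith)
  field_simp
  rw [this]
  field_simp

lemma card_ball {n q : ℕ} (d : ℕ) (v : Fin n → Fin (q+1)) :
    (Finset.univ.filter (fun w => hammingDist v w ≤ d)).card ≤ 2 ^ n * (q+1) ^ d := by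
  classical
  have hsub : (Finset.univ.filter (fun w => hammingDist v w ≤ d)) ⊆
      ((Finset.univ : Finset (Finset (Fin n))).filter (fun S => S.card ≤ d)).biUnion
        (fun S => Fintype.piFinset (fun i => if i ∈ S then Finset.univ else {v i})) := by
    intro w hw
    simp only [Finset.mem_filter, Finset.mem_univ, true_and] at hw
    simp only [Finset.mem_biUnion, Finset.mem_filter, Finset.mem_univ, true_and,
      Fintype.mem_piFinset]
    refine ⟨Finset.univ.filter (fun i => v i ≠ w i), hw, ?_⟩
    intro i
    by_cases h : v i = w i <;> simp [h]
  refine (Finset.card_le_card hsub).trans ?_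
  refine (Finset.card_biUnion_le_card_mul _ _ ((q+1) ^ d) ?_).trans ?_
  · intro S hS
    simp only [Finset.mem_filter, Finset.mem_univ, true_and] at hS
    rw [Fintype.card_piFinset]
    calc _ = ∏ i : Fin n, (if i ∈ S then (q+1) else 1) := by
          apply Finset.prod_congr rfl
          intro i _
          split_ifs <;> simp
      _ = (q+1) ^ S.card := by
          rw [Finset.prod_ite_mem, Finset.univ_inter, Finset.prod_const]
      _ ≤ _ := Nat.pow_le_pow_right (by omega) hS
  · apply Nat.mul_le_mul_right
    refine (Finset.card_filter_le _ _).trans ?_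
    simp

/-- Gilbert–Varshamov inside a finite set. -/
lemma gv {n q : ℕ} (d : ℕ) (S : Finset (Fin n → Fin (q+1))) :
    ∃ C ⊆ S, (∀ v ∈ C, ∀ w ∈ C, v ≠ w → d < hammingDist v w) ∧
      S.card ≤ C.card * (2 ^ n * (q+1) ^ d) := by
  classical
  let F := S.powerset.filter (fun C => ∀ v ∈ C, ∀ w ∈ C, v ≠ w → d < hammingDist v w)
  have hF : F.Nonempty := ⟨∅, by simp [F]⟩
  obtain ⟨C, hC, hmax⟩ := F.exists_max_image Finset.card hF
  simp only [F, Finset.mem_filter, Finset.mem_powerset] at hC hmax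
  refine ⟨C, hC.1, hC.2, ?_⟩
  have hcov : S ⊆ C.biUnion (fun v => Finset.univ.filter (fun w => hammingDist v w ≤ d)) := by
    intro w hw
    by_contra hcon
    simp only [Finset.mem_biUnion, Finset.mem_filter, Finset.mem_univ, true_and, not_exists,
      not_and, not_le] at hcon
    have hwC : w ∉ C := fun h => by
      have := hcon w h
      simp at this
    have := hmax (insert w C) ⟨Finset.insert_subset hw hC.1, by
      intro v hv x hx hne
      rw [Finset.mem_insert] at hv hx
      rcases hv with rfl | hv <;> rcases hx with rfl | hx
      · exact absurd rfl hne
      · rw [hammingDist_comm]; exact hcon x hx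
      · exact hcon v hv
      · exact hC.2 v hv x hx hne⟩
    rw [Finset.card_insert_of_notMem hwC] at this
    omega
  exact (Finset.card_le_card hcov).trans
    (Finset.card_biUnion_le_card_mul _ _ _ fun v _ => card_ball d v)

lemma shell (n q : ℕ) : ∃ (S : Finset (Fin n → Fin (q+1))) (r : ℕ),
    (∀ v ∈ S, ∑ i, (v i : ℕ) ^ 2 = r) ∧ (q+1) ^ n ≤ (n * q ^ 2 + 1) * S.card := by
  classical
  by_contra hcon
  push Not at hcon
  have hmaps : ∀ v ∈ (Finset.univ : Finset (Fin n → Fin (q+1))),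
      ∑ i, (v i : ℕ) ^ 2 ∈ Finset.range (n * q ^ 2 + 1) := by
    intro v _
    rw [Finset.mem_range, Nat.lt_succ_iff]
    calc _ ≤ ∑ i : Fin n, q ^ 2 := by
          apply Finset.sum_le_sum
          intro i _
          exact Nat.pow_le_pow_left (by omega) 2
      _ = _ := by simp
  have hc := Finset.card_eq_sum_card_fiberwise hmaps
  have hb : ∀ r, (n * q ^ 2 + 1) * (Finset.univ.filter
      (fun v : Fin n → Fin (q+1) => ∑ i, (v i : ℕ) ^ 2 = r)).card < (q+1) ^ n := by
    intro r
    apply hcon _ r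
    intro v hv
    simpa using hv
  have h2 : (n * q ^ 2 + 1) * (q+1) ^ n < (n * q ^ 2 + 1) * (q+1) ^ n := by
    calc _ = (n * q ^ 2 + 1) * (Finset.univ : Finset (Fin n → Fin (q+1))).card := by simp
      _ = ∑ r ∈ Finset.range (n * q ^ 2 + 1), (n * q ^ 2 + 1) * (Finset.univ.filter
          (fun v : Fin n → Fin (q+1) => ∑ i, (v i : ℕ) ^ 2 = r)).card := by
          rw [hc, Finset.mul_sum]
      _ < ∑ r ∈ Finset.range (n * q ^ 2 + 1), (q+1) ^ n := by
          apply Finset.sum_lt_sum_of_nonempty ⟨0, by simp⟩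
          intro r _
          exact hb r
      _ = _ := by simp
  exact lt_irrefl _ h2

/-- Codes from shells: alphabet `{0,…,q}/q`. -/
lemma code_exists {l1 l2 κ : ℝ} (hk1 : Real.exp (1 - κ) ≤ l1) (hk2 : Real.exp (1 - κ) ≤ l2)
    {n q d : ℕ} (hn : 1 ≤ n) (hq : 1 ≤ q) (hd : 4 * κ * √n * q ^ 2 ≤ d) :
    ∃ m : ℕ, bernCode (Set.Icc 0 1) n m l1 l2 ∧
      (q+1) ^ n ≤ (n * q ^ 2 + 1) * (m * (2 ^ n * (q+1) ^ d)) := by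
  classical
  obtain ⟨S, r, hS, hcard⟩ := shell n q
  obtain ⟨C, hCS, hdist, hC⟩ := gv d S
  refine ⟨C.card, ?_, hcard.trans (Nat.mul_le_mul_left _ hC)⟩
  have hq0 : (0:ℝ) < q := by exact_mod_cast hq
  let e := C.equivFin.symm
  let u : Fin C.card → Fin n → ℝ := fun j i => (((e j : Fin n → Fin (q+1)) i : ℕ) : ℝ) / q
  have hu : ∀ j i, u j i ∈ Set.Icc (0:ℝ) 1 := by
    intro j i
    refine ⟨by positivity, ?_⟩
    simp only [u]
    rw [div_le_one hq0]
    have : ((e j : Fin n → Fin (q+1)) i : ℕ) ≤ q := by omega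
    exact_mod_cast this
  have hu1 : ∀ j i, |u j i| ≤ 1 := fun j i => by
    rw [abs_of_nonneg (hu j i).1]; exact (hu j i).2
  have hnorm : ∀ j, ∑ i, u j i ^ 2 = r / (q:ℝ) ^ 2 := by
    intro j
    have := hS (e j) (hCS (e j).2)
    simp only [u, div_pow]
    rw [← Finset.sum_div]
    congr 1
    exact_mod_cast this
  have hsep : ∀ j k, j ≠ k → 4 * (κ * √n) ≤ ∑ i, (u j i - u k i) ^ 2 := by
    intro j k hjk
    have hne : (e j : Fin n → Fin (q+1)) ≠ e k := by
      intro h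
      exact hjk (e.injective (Subtype.ext h))
    have hlt := hdist _ (e j).2 _ (e k).2 hne
    have h1 : (d : ℝ) ≤ ∑ i, (q:ℝ) ^ 2 * (u j i - u k i) ^ 2 := by
      calc (d:ℝ) ≤ (hammingDist (e j : Fin n → Fin (q+1)) (e k) : ℝ) := by exact_mod_cast hlt.le
        _ = ∑ i, (if (e j : Fin n → Fin (q+1)) i ≠ (e k : Fin n → Fin (q+1)) i then (1:ℝ) else 0) := by
            rw [hammingDist, Finset.sum_boole]
        _ ≤ _ := by
            apply Finset.sum_le_sum
            intro i _
            split_ifs with h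
            · have h3 : (q:ℝ) ^ 2 * (u j i - u k i) ^ 2 =
                ((((((e j : Fin n → Fin (q+1)) i : ℕ) : ℤ) - (((e k : Fin n → Fin (q+1)) i : ℕ) : ℤ)) ^ 2 : ℤ) : ℝ) := by
                simp only [u]
                push_cast
                field_simp
              rw [h3]
              have h4 : (((e j : Fin n → Fin (q+1)) i : ℕ) : ℤ) - (((e k : Fin n → Fin (q+1)) i : ℕ) : ℤ) ≠ 0 := by
                intro h5
                apply h
                apply Fin.ext
                omega
              have h6 := pow_pos (abs_pos.2 h4) 2
              rw [sq_abs] at h6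
              exact_mod_cast h6
            · positivity
    rw [← Finset.mul_sum] at h1
    have h2 : (q:ℝ) ^ 2 * (4 * (κ * √n)) ≤ (q:ℝ) ^ 2 * ∑ i, (u j i - u k i) ^ 2 := by
      linarith
    exact le_of_mul_le_mul_left h2 (by positivity)
  refine ⟨u, fun j => Finset.univ.filter
    (fun y => -(κ * √n) ≤ ∑ i, u j i * (bit (y i) - u j i)), hu, ?_, ?_⟩
  · intro j
    set E := Finset.univ.filter
      (fun y : Fin n → Bool => -(κ * √n) ≤ ∑ i, u j i * (bit (y i) - u j i)) with hE
    have := chernoff_sqrt hn (hu j) (a := fun i => - u j i) (κ := κ)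
      (fun i => by rw [abs_neg]; exact hu1 j i) Eᶜ (by
        intro y hy
        simp only [hE, Finset.mem_compl, Finset.mem_filter, Finset.mem_univ, true_and,
          not_le] at hy
        simp only [neg_mul, Finset.sum_neg_distrib]
        linarith)
    linarith [bprob_compl (u j) E]
  · intro j k hjk
    refine (chernoff_sqrt hn (hu j) (a := u k) (κ := κ) (hu1 k) _ ?_).trans hk2
    intro y hy
    simp only [Finset.mem_filter, Finset.mem_univ, true_and] at hy
    have hs := hsep j k hjk
    have : ∑ i, u k i * (bit (y i) - u j i) =
        ∑ i, u k i * (bit (y i) - u k i) + (1/2) * ∑ i, (u j i - u k i) ^ 2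
          + (1/2) * (∑ i, u k i ^ 2 - ∑ i, u j i ^ 2) := by
      rw [← Finset.sum_sub_distrib, Finset.mul_sum, Finset.mul_sum, ← Finset.sum_add_distrib,
        ← Finset.sum_add_distrib]
      apply Finset.sum_congr rfl
      intro i _
      ring
    rw [this, hnorm, hnorm]
    linarith

/-! Upper bound -/

noncomputable def ang (x : ℝ) : ℝ := Real.arcsin (√x)

lemma bc_letter {x x' : ℝ} (hx : x ∈ Set.Icc (0:ℝ) 1) (hx' : x' ∈ Set.Icc (0:ℝ) 1) :
    √(bern x true) * √(bern x' true) + √(bern x false) * √(bern x' false) =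
      Real.cos (ang x - ang x') := by
  have hs : ∀ z ∈ Set.Icc (0:ℝ) 1, Real.sin (ang z) = √z := fun z hz =>
    Real.sin_arcsin (by linarith [Real.sqrt_nonneg z]) (Real.sqrt_le_one.2 hz.2)
  have hc : ∀ z ∈ Set.Icc (0:ℝ) 1, Real.cos (ang z) = √(1 - z) := fun z hz => by
    rw [ang, Real.cos_arcsin, Real.sq_sqrt hz.1]
  rw [Real.cos_sub, hs x hx, hs x' hx', hc x hx, hc x' hx']
  simp [bern]
  ring

lemma tv_bound {n : ℕ} {u v : Fin n → ℝ} {D : ℝ} (hu : ∀ i, u i ∈ Set.Icc (0:ℝ) 1)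
    (hv : ∀ i, v i ∈ Set.Icc (0:ℝ) 1) (hD1 : D ≤ 1)
    (h : ∀ i, |ang (u i) - ang (v i)| ≤ D) (hD0 : 0 ≤ D) (E : Finset (Fin n → Bool)) :
    (bprob u E - bprob v E) ^ 2 ≤ 4 * (n * D ^ 2) := by
  have hbc : 1 - n * D ^ 2 / 2 ≤ ∑ y, √(bprod u y) * √(bprod v y) := by
    have e : ∀ y : Fin n → Bool, √(bprod u y) * √(bprod v y) =
        ∏ i, (fun (i : Fin n) (b : Bool) => √(bern (u i) b) * √(bern (v i) b)) i (y i) := by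
      intro y
      rw [bprod, bprod, Real.sqrt_prod _ (fun i _ => bern_nonneg (hu i) _),
        Real.sqrt_prod _ (fun i _ => bern_nonneg (hv i) _), Finset.prod_mul_distrib]
    rw [Finset.sum_congr rfl (fun y _ => e y),
      sum_prod_bool (fun (i : Fin n) (b : Bool) => √(bern (u i) b) * √(bern (v i) b))]
    have hb := one_add_mul_le_pow (a := - (D ^ 2 / 2)) (by nlinarith) n
    calc _ ≤ (1 + - (D ^ 2 / 2)) ^ n := by linarith
      _ = ∏ i : Fin n, (1 + - (D ^ 2 / 2)) := by simp
      _ ≤ _ := by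
        apply Finset.prod_le_prod
        · intro i _; nlinarith
        · intro i _
          rw [bc_letter (hu i) (hv i)]
          have := Real.one_sub_sq_div_two_le_cos (x := ang (u i) - ang (v i))
          have h2 := sq_le_sq' (by linarith [abs_nonneg (ang (u i) - ang (v i))]) (h i)
          rw [sq_abs] at h2
          linarith
  have e1 : ∀ y, √(bprod u y) ^ 2 = bprod u y := fun y => Real.sq_sqrt (bprod_nonneg hu y)
  have e2 : ∀ y, √(bprod v y) ^ 2 = bprod v y := fun y => Real.sq_sqrt (bprod_nonneg hv y)
  have hcs := Finset.sum_mul_sq_le_sq_mul_sq E (fun y => √(bprod u y) - √(bprod v y))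
    (fun y => √(bprod u y) + √(bprod v y))
  have l : bprob u E - bprob v E =
      ∑ y ∈ E, (√(bprod u y) - √(bprod v y)) * (√(bprod u y) + √(bprod v y)) := by
    rw [bprob, bprob, ← Finset.sum_sub_distrib]
    apply Finset.sum_congr rfl
    intro y _
    nlinarith [e1 y, e2 y]
  rw [l]
  refine hcs.trans ?_
  have A : ∑ y ∈ E, (√(bprod u y) - √(bprod v y)) ^ 2 ≤ n * D ^ 2 := by
    calc _ ≤ ∑ y, (√(bprod u y) - √(bprod v y)) ^ 2 :=
          Finset.sum_le_sum_of_subset_of_nonneg (Finset.subset_univ _)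
            (fun y _ _ => sq_nonneg _)
      _ = ∑ y, bprod u y + ∑ y, bprod v y - 2 * ∑ y, √(bprod u y) * √(bprod v y) := by
          rw [Finset.mul_sum, ← Finset.sum_add_distrib, ← Finset.sum_sub_distrib]
          apply Finset.sum_congr rfl
          intro y _
          nlinarith [e1 y, e2 y]
      _ ≤ _ := by rw [bprod_sum, bprod_sum]; linarith
  have B : ∑ y ∈ E, (√(bprod u y) + √(bprod v y)) ^ 2 ≤ 4 := by
    calc _ ≤ ∑ y, (√(bprod u y) + √(bprod v y)) ^ 2 :=
          Finset.sum_le_sum_of_subset_of_nonneg (Finset.subset_univ _)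
            (fun y _ _ => sq_nonneg _)
      _ ≤ ∑ y, (2 * bprod u y + 2 * bprod v y) := by
          apply Finset.sum_le_sum
          intro y _
          nlinarith [e1 y, e2 y, sq_nonneg (√(bprod u y) - √(bprod v y))]
      _ = _ := by
          rw [Finset.sum_add_distrib, ← Finset.mul_sum, ← Finset.mul_sum, bprod_sum, bprod_sum]
          norm_num
  have A0 : 0 ≤ ∑ y ∈ E, (√(bprod u y) + √(bprod v y)) ^ 2 :=
    Finset.sum_nonneg fun y _ => sq_nonneg _
  have : 0 ≤ (n:ℝ) * D ^ 2 := by positivity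
  nlinarith

lemma code_upper {l1 l2 D : ℝ} {n m : ℕ} (h12 : l1 + l2 < 1) (hD0 : 0 < D) (hD1 : D ≤ 1)
    (hD : 4 * (n * D ^ 2) < (1 - l1 - l2) ^ 2) (hc : bernCode (Set.Icc 0 1) n m l1 l2) :
    m ≤ (⌊2 / D⌋₊ + 1) ^ n := by
  obtain ⟨u, E, hu, hE1, hE2⟩ := hc
  have hang0 : ∀ x, 0 ≤ ang x := fun x => Real.arcsin_nonneg.2 (Real.sqrt_nonneg x)
  have hang1 : ∀ x, ang x ≤ 2 := fun x => (Real.arcsin_le_pi_div_two _).trans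
    (by linarith [Real.pi_le_four])
  let f : Fin m → Fin n → Fin (⌊2 / D⌋₊ + 1) := fun j i =>
    ⟨⌊ang (u j i) / D⌋₊, Nat.lt_succ_of_le (Nat.floor_le_floor (by gcongr; exact hang1 _))⟩
  have hf : Function.Injective f := by
    intro j k hjk
    by_contra hne
    have hcell : ∀ i, |ang (u k i) - ang (u j i)| ≤ D := by
      intro i
      have hi := congrArg Fin.val (congrFun hjk i)
      simp only [f] at hi
      have a1 := Nat.floor_le (div_nonneg (hang0 (u j i)) hD0.le)
      have a2 := Nat.lt_floor_add_one (ang (u j i) / D)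
      have b1 := Nat.floor_le (div_nonneg (hang0 (u k i)) hD0.le)
      have b2 := Nat.lt_floor_add_one (ang (u k i) / D)
      rw [hi] at a1 a2
      rw [le_div_iff₀ hD0] at a1 b1
      rw [div_lt_iff₀ hD0] at a2 b2
      rw [abs_le]
      constructor <;> linarith
    have := tv_bound (hu k) (hu j) hD1 hcell hD0.le (E k)
    have g1 := hE1 k
    have g2 := hE2 j k hne
    nlinarith
  have := Fintype.card_le_of_injective f hf
  simpa using this

lemma upper_asymp {l1 l2 : ℝ} (h1 : 0 < l1) (h2 : 0 < l2) (h12 : l1 + l2 < 1) :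
    ∃ L : ℝ, ∀ n m : ℕ, 2 ≤ n → 1 ≤ m → bernCode (Set.Icc 0 1) n m l1 l2 →
      Real.log m ≤ n * (L + Real.log n / 2) := by
  set c := (1 - l1 - l2) / 3 with hc
  have hc0 : 0 < c := by rw [hc]; linarith
  have hc1 : c ≤ 1 := by rw [hc]; linarith
  refine ⟨Real.log (2 / c + 1), fun n m hn hm hcode => ?_⟩
  have hn' : (2:ℝ) ≤ n := by exact_mod_cast hn
  have hs : 1 ≤ √(n:ℝ) := Real.one_le_sqrt.2 (by linarith)
  have hsp : 0 < √(n:ℝ) := by linarith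
  have hsq : √(n:ℝ) ^ 2 = n := Real.sq_sqrt (by linarith)
  have hb := code_upper (D := c / √n) h12 (by positivity)
    (by rw [div_le_one hsp]; linarith) (by
      rw [div_pow, hsq, mul_div_cancel₀ _ (by linarith)]
      have : 1 - l1 - l2 = 3 * c := by rw [hc]; ring
      rw [this]; nlinarith) hcode
  have hK : ((⌊2 / (c / √n)⌋₊ + 1 : ℕ) : ℝ) ≤ (2 / c + 1) * √n := by
    have := Nat.floor_le (a := 2 / (c / √n)) (by positivity)
    push_cast
    have e : 2 / (c / √n) = 2 / c * √n := by field_simp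
    rw [e] at this ⊢
    linarith
  have hm0 : (0:ℝ) < m := by exact_mod_cast hm
  calc Real.log m ≤ Real.log (((2 / c + 1) * √n) ^ n) := by
        apply Real.log_le_log hm0
        calc (m:ℝ) ≤ ((⌊2 / (c / √n)⌋₊ + 1 : ℕ) : ℝ) ^ n := by exact_mod_cast hb
          _ ≤ _ := pow_le_pow_left₀ (by positivity) hK n
    _ = _ := by
        rw [Real.log_pow, Real.log_mul (by positivity) (by positivity), Real.log_sqrt (by linarith)]

set_option maxHeartbeats 1000000 in
lemma lower_asymp {l1 l2 α : ℝ} (h1 : 0 < l1) (h2 : 0 < l2) (h12 : l1 + l2 < 1)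
    (hα : 0 < α) (hα1 : α < 1) :
    ∃ L : ℝ, ∀ᶠ n : ℕ in atTop, ∃ m : ℕ, 1 ≤ m ∧ bernCode (Set.Icc 0 1) n m l1 l2 ∧
      (n - α * n - 1) * (Real.log n / 4 - L) - n * Real.log 2 - 4 * Real.log n ≤ Real.log m := by
  set l := min l1 l2 with hl
  have hl0 : 0 < l := lt_min h1 h2
  have hl1 : l < 1 := by linarith [min_le_left l1 l2]
  set κ := 1 - Real.log l with hκ
  have hκ1 : 1 < κ := by linarith [Real.log_neg hl0 hl1]
  have hexp : Real.exp (1 - κ) = l := by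
    rw [hκ, sub_sub_cancel, Real.exp_log hl0]
  set c := √(α / (4 * κ)) with hc
  have hc0 : 0 < c := Real.sqrt_pos.2 (by positivity)
  have hcsq : c ^ 2 = α / (4 * κ) := Real.sq_sqrt (by positivity)
  have hc1 : c ≤ 1 := by
    rw [hc]; apply Real.sqrt_le_one.2; rw [div_le_one (by positivity)]; linarith
  clear_value c
  have ht : Tendsto (fun n : ℕ => c * √(√(n:ℝ))) atTop atTop :=
    (Real.tendsto_sqrt_atTop.comp (Real.tendsto_sqrt_atTop.comp
      tendsto_natCast_atTop_atTop)).const_mul_atTop hc0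
  refine ⟨- Real.log c, ?_⟩
  have hev2 : ∀ᶠ n : ℕ in atTop, 1 + 1 ≤ (1 - α) * (n : ℝ) :=
    (tendsto_natCast_atTop_atTop.const_mul_atTop (by linarith : 0 < 1 - α)).eventually_ge_atTop _
  filter_upwards [ht.eventually_ge_atTop 1, eventually_ge_atTop 2, hev2] with n hn1 hn2 hn3
  have hn' : (2:ℝ) ≤ n := by exact_mod_cast hn2
  have hs : 1 ≤ √(n:ℝ) := Real.one_le_sqrt.2 (by linarith)
  have hsq : √(n:ℝ) ^ 2 = n := Real.sq_sqrt (by linarith)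
  have hssq : √(√(n:ℝ)) ^ 2 = √n := Real.sq_sqrt (by linarith)
  have hss : 1 ≤ √(√(n:ℝ)) := Real.one_le_sqrt.2 hs
  set q := ⌊c * √(√(n:ℝ))⌋₊ with hq
  have hq1 : 1 ≤ q := Nat.le_floor (by simpa using hn1)
  have hqle : (q:ℝ) ≤ c * √(√(n:ℝ)) := Nat.floor_le (by positivity)
  have hqlt : c * √(√(n:ℝ)) ≤ ((q + 1 : ℕ) : ℝ) := by
    push_cast; exact (Nat.lt_floor_add_one _).le
  have hq0 : (0:ℝ) ≤ q := by positivity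
  have hqsq : (q:ℝ) ^ 2 ≤ α / (4 * κ) * √n := by
    calc (q:ℝ) ^ 2 ≤ (c * √(√(n:ℝ))) ^ 2 := pow_le_pow_left₀ hq0 hqle 2
      _ = _ := by rw [mul_pow, hcsq, hssq]
  set d := ⌈α * n⌉₊ with hd
  have hdge : α * n ≤ d := Nat.le_ceil _
  have hdle : (d:ℝ) ≤ α * n + 1 := (Nat.ceil_lt_add_one (by positivity)).le
  obtain ⟨m, hcode, hcount⟩ := code_exists (l1 := l1) (l2 := l2) (κ := κ)
    (by rw [hexp]; exact min_le_left _ _) (by rw [hexp]; exact min_le_right _ _)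
    (n := n) (q := q) (d := d) (by omega) hq1 (by
      calc 4 * κ * √n * q ^ 2 ≤ 4 * κ * √n * (α / (4 * κ) * √n) := by gcongr
        _ = α * √n ^ 2 := by field_simp
        _ = α * n := by rw [hsq]
        _ ≤ d := hdge)
  have hm : 1 ≤ m := by
    by_contra hm
    have : m = 0 := by omega
    subst this
    have : 0 < (q+1) ^ n := by positivity
    simp at hcount
  refine ⟨m, hm, hcode, ?_⟩
  have hm0 : (0:ℝ) < m := by exact_mod_cast hm
  have hQ : (0:ℝ) < ((q+1:ℕ):ℝ) := by positivity
  have hcR : ((q+1:ℕ):ℝ) ^ n ≤ ((n:ℝ) * q ^ 2 + 1) * (m * (2 ^ n * ((q+1:ℕ):ℝ) ^ d)) := by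
    exact_mod_cast hcount
  have hlog := Real.log_le_log (by positivity) hcR
  have hp : (0:ℝ) < (n:ℝ) * q ^ 2 + 1 := by positivity
  rw [Real.log_mul hp.ne' (by positivity), Real.log_mul hm0.ne' (by positivity),
    Real.log_mul (by positivity) (by positivity), Real.log_pow, Real.log_pow, Real.log_pow] at hlog
  have hlp : Real.log ((n:ℝ) * q ^ 2 + 1) ≤ 4 * Real.log n := by
    have : Real.log ((n:ℝ) ^ 4) = 4 * Real.log n := by rw [Real.log_pow]; norm_num
    rw [← this]
    apply Real.log_le_log hp
    have hqn : (q:ℝ) ^ 2 ≤ n := by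
      calc (q:ℝ) ^ 2 ≤ (c * √(√(n:ℝ))) ^ 2 := pow_le_pow_left₀ hq0 hqle 2
        _ = c ^ 2 * √n := by rw [mul_pow, hssq]
        _ ≤ 1 * √n := by
          apply mul_le_mul_of_nonneg_right _ (by linarith)
          exact pow_le_one₀ hc0.le hc1
        _ ≤ n := by
          rw [one_mul, ← hsq, Real.sqrt_sq (by linarith)]
          exact le_self_pow₀ hs (by norm_num)
    have t1 : (n:ℝ) * q ^ 2 ≤ n * n := mul_le_mul_of_nonneg_left hqn (by linarith)
    have t2 : (2:ℝ) * 2 ≤ n * n := mul_le_mul hn' hn' (by norm_num) (by linarith)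
    have t3 : (n:ℝ) ^ 4 = (n * n) * (n * n) := by ring
    have t4 : (2 * 2) * ((n:ℝ) * n) ≤ (n * n) * (n * n) :=
      mul_le_mul_of_nonneg_right t2 (by linarith)
    rw [t3]
    linarith
  have hlq : Real.log n / 4 + Real.log c ≤ Real.log ((q+1:ℕ):ℝ) := by
    have h := Real.log_le_log (by positivity) hqlt
    rw [Real.log_mul hc0.ne' (by positivity), Real.log_sqrt (by positivity),
      Real.log_sqrt (by positivity)] at h
    linarith
  have hlq0 : 0 ≤ Real.log ((q+1:ℕ):ℝ) := Real.log_nonneg (by push_cast; linarith)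
  have k1 : (n - α * n - 1) * (Real.log n / 4 + Real.log c) ≤
      (n - α * n - 1) * Real.log ((q+1:ℕ):ℝ) :=
    mul_le_mul_of_nonneg_left hlq (by linarith)
  have k2 : (n - α * n - 1) * Real.log ((q+1:ℕ):ℝ) ≤ (n - d) * Real.log ((q+1:ℕ):ℝ) :=
    mul_le_mul_of_nonneg_right (by linarith) hlq0
  rw [sub_neg_eq_add]
  linarith

end Bern

theorem stmt7 (l1 l2 : ℝ) (h1 : 0 < l1) (h2 : 0 < l2) (h12 : l1 + l2 < 1)
    (N : ℕ → ℕ)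
    (hN : ∀ n, IsGreatest {m : ℕ | bernCode (Set.Icc 0 1) n m l1 l2} (N n)) :
    (1 / 4 : ℝ) ≤
        Filter.liminf (fun n : ℕ =>
          Real.logb 2 (N n) / ((n : ℝ) * Real.logb 2 n)) Filter.atTop ∧
      Filter.limsup (fun n : ℕ =>
          Real.logb 2 (N n) / ((n : ℝ) * Real.logb 2 n)) Filter.atTop ≤ (1 / 2 : ℝ) := by
  have hrat : ∀ n : ℕ, Real.logb 2 (N n) / ((n : ℝ) * Real.logb 2 n) =
      Real.log (N n) / (n * Real.log n) := by
    intro n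
    have : Real.log 2 ≠ 0 := (Real.log_pos (by norm_num)).ne'
    simp only [Real.logb]
    rw [← mul_div_assoc, div_div_div_cancel_right₀ this]
  simp_rw [hrat]
  set f : ℕ → ℝ := fun n => Real.log (N n) / (n * Real.log n) with hf
  have hlogt : Tendsto (fun n : ℕ => Real.log n) atTop atTop :=
    Real.tendsto_log_atTop.comp tendsto_natCast_atTop_atTop
  have hf0 : ∀ n, 0 ≤ f n := fun n =>
    div_nonneg (Real.log_natCast_nonneg _) (mul_nonneg (by positivity) (Real.log_natCast_nonneg _))
  have hinv : ∀ a : ℝ, Tendsto (fun n : ℕ => a / Real.log n) atTop (nhds 0) := fun a =>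
    hlogt.const_div_atTop a
  -- upper bound
  have hup : ∀ ε > 0, ∀ᶠ n in atTop, f n ≤ 1 / 2 + ε := by
    intro ε hε
    obtain ⟨L, hL⟩ := upper_asymp h1 h2 h12
    filter_upwards [(hinv L).eventually_lt_const hε, eventually_ge_atTop 2] with n hn hn2
    have hn' : (2:ℝ) ≤ n := by exact_mod_cast hn2
    have hlog : 0 < Real.log n := Real.log_pos (by linarith)
    rcases Nat.eq_zero_or_pos (N n) with h0 | hpos
    · simp only [hf, h0]; simp; positivity
    · have := hL n (N n) hn2 hpos (hN n).1
      simp only [hf]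
      rw [div_le_iff₀ (by positivity)]
      rw [div_lt_iff₀ hlog] at hn
      have h5 : (n:ℝ) * (L + Real.log n / 2) ≤ n * (ε * Real.log n + Real.log n / 2) := by
        gcongr
      linarith
  have hlow : ∀ α : ℝ, 0 < α → α < 1 → ∀ ε > 0, ∀ᶠ n in atTop, (1 - α) / 4 - ε ≤ f n := by
    intro α hα hα1 ε hε
    obtain ⟨L, hL⟩ := lower_asymp h1 h2 h12 hα hα1
    have hn0 : ∀ a : ℝ, Tendsto (fun n : ℕ => a / (n:ℝ)) atTop (nhds 0) := fun a =>
      tendsto_natCast_atTop_atTop.const_div_atTop a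
    have hT : Tendsto (fun n : ℕ => (1 - α - 1 / (n:ℝ)) * (1 / 4 - L / Real.log n)
        - Real.log 2 / Real.log n - 4 / (n:ℝ)) atTop
        (nhds ((1 - α - 0) * (1 / 4 - 0) - 0 - 0)) :=
      (((tendsto_const_nhds.sub (hn0 1)).mul (tendsto_const_nhds.sub (hinv L))).sub
        (hinv _)).sub (hn0 4)
    filter_upwards [hL, eventually_ge_atTop 2,
      hT.eventually_const_lt (u := (1 - α) / 4 - ε) (by linarith)] with n ⟨m, hm, hcode, hb⟩ hn2 hlt
    have hn' : (2:ℝ) ≤ n := by exact_mod_cast hn2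
    have hlog : 0 < Real.log n := Real.log_pos (by linarith)
    have hmN : m ≤ N n := (hN n).2 hcode
    have hm0 : (0:ℝ) < m := by exact_mod_cast hm
    have hlm : Real.log m ≤ Real.log (N n) := Real.log_le_log hm0 (by exact_mod_cast hmN)
    refine hlt.le.trans ?_
    simp only [hf]
    rw [le_div_iff₀ (by positivity)]
    refine le_trans (le_of_eq ?_) (hb.trans hlm)
    field_simp
  have hbdd : IsBoundedUnder (· ≤ ·) atTop f := ⟨1 / 2 + 1, by
    simpa using hup 1 one_pos⟩
  have hbdd' : IsBoundedUnder (· ≥ ·) atTop f := ⟨0, by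
    exact Filter.eventually_map.2 (Filter.Eventually.of_forall hf0)⟩
  constructor
  · apply le_of_forall_pos_le_add
    intro ε hε
    have hα : ∃ α : ℝ, 0 < α ∧ α < 1 ∧ α ≤ ε := ⟨min (1/2) ε, by positivity,
      (min_le_left _ _).trans_lt (by norm_num), min_le_right _ _⟩
    obtain ⟨α, ha0, ha1, haε⟩ := hα
    have := le_liminf_of_le hbdd.isCoboundedUnder_ge (hlow α ha0 ha1 (ε / 2) (by linarith))
    linarith
  · apply le_of_forall_pos_le_add
    intro ε hε
    exact limsup_le_of_le hbdd'.isCoboundedUnder_le (hup ε hε)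
end

section
/- For the discrete-time Poisson channel P with average power constraint E > 0, and every λ₁, λ₂ > 0 with λ₁ + λ₂ < 1, the maximal deterministic identification code sizes satisfy 1/4 ≤ liminf_{n→∞} (1/(n log₂ n)) · log₂ N_DI^E(n,λ₁,λ₂) and limsup_{n→∞} (1/(n log₂ n)) · log₂ N_DI^E(n,λ₁,λ₂) ≤ 1/2. -/
open Real Filter

namespace Pois

/-- The Poisson distribution `P_x` on `ℕ` with parameter `x ≥ 0`. -/
noncomputable def poisP (x : ℝ) (y : ℕ) : ℝ := Real.exp (-x) * x ^ y / (Nat.factorial y)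

/-- Product Poisson distribution `P_{x^n}` on `ℕ^n`. -/
noncomputable def pprod {n : ℕ} (u : Fin n → ℝ) (y : Fin n → ℕ) : ℝ :=
  ∏ i, poisP (u i) (y i)

/-- Probability of a set of output words under `P_{x^n}`. -/
noncomputable def pprob {n : ℕ} (u : Fin n → ℝ) (D : Set (Fin n → ℕ)) : ℝ :=
  ∑' y : D, pprod u y

/-- An `(n,N,λ₁,λ₂)`-deterministic identification code for the Poisson channel under the
average power constraint `∑ i x_i ≤ n·En`. -/
def poisCode (En : ℝ) (n N : ℕ) (l1 l2 : ℝ) : Prop :=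
  ∃ (u : Fin N → Fin n → ℝ) (D : Fin N → Set (Fin n → ℕ)),
    (∀ j i, 0 ≤ u j i) ∧
    (∀ j, ∑ i, u j i ≤ (n : ℝ) * En) ∧
    (∀ j, 1 - l1 ≤ pprob (u j) (D j)) ∧
    (∀ j k, j ≠ k → pprob (u j) (D k) ≤ l2)

end Pois

open Pois

namespace PoisAux
open MeasureTheory ProbabilityTheory
open Pois

noncomputable def mu {n : ℕ} (u : Fin n → ℝ) : Measure (Fin n → ℕ) :=
  Measure.pi (fun i => poissonMeasure (u i).toNNReal)

instance {n : ℕ} (u : Fin n → ℝ) : IsProbabilityMeasure (mu u) := by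
  unfold mu; infer_instance

lemma poisP_nonneg {x : ℝ} (hx : 0 ≤ x) (y : ℕ) : 0 ≤ poisP x y := by
  unfold poisP; positivity

lemma pprod_nonneg {n : ℕ} {u : Fin n → ℝ} (hu : ∀ i, 0 ≤ u i) (y : Fin n → ℕ) :
    0 ≤ pprod u y := Finset.prod_nonneg fun i _ => poisP_nonneg (hu i) _

lemma mu_singleton {n : ℕ} {u : Fin n → ℝ} (hu : ∀ i, 0 ≤ u i) (y : Fin n → ℕ) :
    mu u {y} = ENNReal.ofReal (pprod u y) := by
  unfold mu pprod
  rw [Measure.pi_singleton, ENNReal.ofReal_prod_of_nonneg (fun i _ => poisP_nonneg (hu i) _)]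
  refine Finset.prod_congr rfl fun i _ => ?_
  rw [poissonMeasure_singleton, Real.coe_toNNReal _ (hu i), poisP]

lemma mu_apply {n : ℕ} (u : Fin n → ℝ) (D : Set (Fin n → ℕ)) :
    mu u D = ∑' y : D, mu u {(y : Fin n → ℕ)} := by
  rw [← Measure.tsum_indicator_apply_singleton (mu u) D (MeasurableSet.of_discrete),
    ← tsum_subtype D (fun x => mu u {x})]

lemma pprob_eq {n : ℕ} {u : Fin n → ℝ} (hu : ∀ i, 0 ≤ u i) (D : Set (Fin n → ℕ)) :
    pprob u D = (mu u).real D := by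
  rw [Measure.real, mu_apply, ENNReal.tsum_toReal_eq (fun a => measure_ne_top _ _)]
  refine tsum_congr fun y => ?_
  rw [mu_singleton hu, ENNReal.toReal_ofReal (pprod_nonneg hu _)]

lemma summable_pprod {n : ℕ} {u : Fin n → ℝ} (hu : ∀ i, 0 ≤ u i) : Summable (pprod u) := by
  have h : Summable (fun y => (mu u {y}).toReal) := by
    apply ENNReal.summable_toReal
    have := Measure.tsum_indicator_apply_singleton (mu u) Set.univ MeasurableSet.univ
    simp only [Set.indicator_univ] at this
    rw [this]; exact measure_ne_top _ _
  refine h.congr fun y => ?_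
  rw [mu_singleton hu, ENNReal.toReal_ofReal (pprod_nonneg hu _)]

lemma tsum_pprod {n : ℕ} {u : Fin n → ℝ} (hu : ∀ i, 0 ≤ u i) : ∑' y, pprod u y = 1 := by
  have := pprob_eq hu Set.univ
  rw [pprob, tsum_univ (pprod u)] at this
  rw [this]; simp

/-- affinity -/
lemma sqrt_pprod {n : ℕ} {u v : Fin n → ℝ} (hu : ∀ i, 0 ≤ u i) (hv : ∀ i, 0 ≤ v i)
    (y : Fin n → ℕ) :
    Real.sqrt (pprod u y) * Real.sqrt (pprod v y) =
      Real.exp (-(∑ i, (Real.sqrt (u i) - Real.sqrt (v i)) ^ 2) / 2) *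
        pprod (fun i => Real.sqrt (u i) * Real.sqrt (v i)) y := by
  rw [← Real.sqrt_mul (pprod_nonneg hu _)]
  rw [Real.sqrt_eq_iff_mul_self_eq (mul_nonneg (pprod_nonneg hu _) (pprod_nonneg hv _))
    (mul_nonneg (Real.exp_nonneg _) (pprod_nonneg (fun i => by positivity) _))]
  rw [neg_div, Finset.sum_div, ← Finset.sum_neg_distrib, Real.exp_sum]
  unfold pprod
  rw [← Finset.prod_mul_distrib, ← Finset.prod_mul_distrib, ← Finset.prod_mul_distrib]
  refine Finset.prod_congr rfl fun i _ => ?_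
  obtain ⟨a, ha, hua⟩ : ∃ a, 0 ≤ a ∧ u i = a ^ 2 := ⟨√(u i), Real.sqrt_nonneg _, (Real.sq_sqrt (hu i)).symm⟩
  obtain ⟨b, hb, hvb⟩ : ∃ a, 0 ≤ a ∧ v i = a ^ 2 := ⟨√(v i), Real.sqrt_nonneg _, (Real.sq_sqrt (hv i)).symm⟩
  simp only [poisP]
  rw [hua, hvb, Real.sqrt_sq ha, Real.sqrt_sq hb]
  have e1 : Real.exp (-(a^2)) * Real.exp (-(b^2)) =
      (Real.exp (-((a - b) ^ 2 / 2)) * Real.exp (-(a * b))) * (Real.exp (-((a - b) ^ 2 / 2)) * Real.exp (-(a * b))) := by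
    simp only [← Real.exp_add]; congr 1; ring
  generalize Real.exp (-(a^2)) = A at *
  generalize Real.exp (-(b^2)) = B at *
  generalize Real.exp (-((a - b) ^ 2 / 2)) = C at *
  generalize Real.exp (-(a * b)) = G at *
  calc _ = (A * B) * ((a * b) ^ y i * (a*b) ^ y i) / ((y i).factorial * (y i).factorial) := by
        rw [mul_pow]; ring
    _ = _ := by rw [e1]; ring

lemma separation {n : ℕ} {u v : Fin n → ℝ} (hu : ∀ i, 0 ≤ u i) (hv : ∀ i, 0 ≤ v i)
    (D : Set (Fin n → ℕ)) {η : ℝ} (hη : 0 < η) (h : η ≤ pprob u D - pprob v D) :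
    η ^ 2 / 4 ≤ ∑ i, (Real.sqrt (u i) - Real.sqrt (v i)) ^ 2 := by
  set d := ∑ i, (Real.sqrt (u i) - Real.sqrt (v i)) ^ 2 with hd
  set w : Fin n → ℝ := fun i => Real.sqrt (u i) * Real.sqrt (v i) with hw
  have hw0 : ∀ i, 0 ≤ w i := fun i => by positivity
  have su := summable_pprod hu
  have sv := summable_pprod hv
  have sw := summable_pprod hw0
  set F : (Fin n → ℕ) → ℝ := fun y => (η / 4) * (pprod u y + pprod v y) +
    (2 / η) * (pprod u y + pprod v y - 2 * (Real.exp (-d / 2) * pprod w y)) with hF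
  have hle : ∀ y, |pprod u y - pprod v y| ≤ F y := by
    intro y
    have hs := sqrt_pprod hu hv y
    rw [← hd] at hs
    simp only [hF]
    rw [← hs]
    obtain ⟨a, ha, hua⟩ : ∃ a, 0 ≤ a ∧ pprod u y = a ^ 2 := ⟨√(pprod u y), Real.sqrt_nonneg _, (Real.sq_sqrt (pprod_nonneg hu y)).symm⟩
    obtain ⟨b, hb, hvb⟩ : ∃ a, 0 ≤ a ∧ pprod v y = a ^ 2 := ⟨√(pprod v y), Real.sqrt_nonneg _, (Real.sq_sqrt (pprod_nonneg hv y)).symm⟩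
    rw [hua, hvb, Real.sqrt_sq ha, Real.sqrt_sq hb]
    have e : a ^ 2 + b ^ 2 - 2 * (a * b) = (a - b) ^ 2 := by ring
    rw [e]
    have h2 : (η / 8) * (a + b) ^ 2 ≤ (η / 4) * (a ^ 2 + b ^ 2) := by
      nlinarith [mul_nonneg hη.le (sq_nonneg (a - b))]
    refine le_trans ?_ (add_le_add_left h2 _)
    have e2 : a ^ 2 - b ^ 2 = (a - b) * (a + b) := by ring
    rw [e2]
    have key : ∀ s t : ℝ, s * t ≤ η / 8 * t ^ 2 + 2 / η * s ^ 2 := by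
      intro s t
      have : η / 8 * t ^ 2 + 2 / η * s ^ 2 - s * t = (η * t - 4 * s) ^ 2 / (8 * η) := by
        field_simp; ring
      have h3 : 0 ≤ (η * t - 4 * s) ^ 2 / (8 * η) := by positivity
      linarith
    rw [abs_le]
    have k1 := key (a - b) (a + b)
    have k2 := key (-(a - b)) (a + b)
    constructor <;> nlinarith
  have sF : Summable F := ((su.add sv).mul_left _).add
    (((su.add sv).sub ((sw.mul_left _).mul_left _)).mul_left _)
  have tF : ∑' y, F y = (η / 4) * (1 + 1) + (2 / η) * (1 + 1 - 2 * (Real.exp (-d / 2) * 1)) := by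
    have HU : HasSum (pprod u) 1 := by rw [← tsum_pprod hu]; exact su.hasSum
    have HV : HasSum (pprod v) 1 := by rw [← tsum_pprod hv]; exact sv.hasSum
    have HW : HasSum (pprod w) 1 := by rw [← tsum_pprod hw0]; exact sw.hasSum
    exact (((HU.add HV).mul_left _).add
      (((HU.add HV).sub ((HW.mul_left _).mul_left _)).mul_left _)).tsum_eq
  have hD : pprob u D - pprob v D ≤ ∑' y, F y := by
    unfold pprob
    have hsub := (su.subtype D).tsum_sub (sv.subtype D)
    simp only [Function.comp_def] at hsub
    refine hsub.symm.le.trans ?_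
    calc _ ≤ ∑' y : D, F y := by
          refine ((su.subtype D).sub (sv.subtype D)).tsum_le_tsum ?_ (sF.subtype D)
          intro y; exact (le_abs_self _).trans (hle y.1)
      _ ≤ ∑' y, F y := by
          refine Summable.tsum_subtype_le F D ?_ sF
          intro y; exact (abs_nonneg _).trans (hle y)
  rw [tF] at hD
  have h4 : 1 - Real.exp (-d / 2) ≤ d / 2 := by
    have := Real.add_one_le_exp (-d / 2); linarith
  have h5 : η ≤ η / 2 + (2 / η) * d := by
    have : (2 / η) * (1 + 1 - 2 * (Real.exp (-d / 2) * 1)) ≤ (2 / η) * d := by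
      apply mul_le_mul_of_nonneg_left _ (by positivity); linarith
    linarith
  have h6 : η * η ≤ η * (η / 2 + (2 / η) * d) := mul_le_mul_of_nonneg_left h5 hη.le
  have h7 : η * (η / 2 + (2 / η) * d) = η ^ 2 / 2 + 2 * d := by field_simp
  nlinarith

lemma hasSum_p (v : NNReal) :
    HasSum (fun y : ℕ => Real.exp (-v) * (v : ℝ) ^ y / (y.factorial : ℝ)) 1 :=
  hasSum_one_poissonMeasure v

lemma hasSum_shift (v : NNReal) (g : ℕ → ℝ) (s : ℝ)
    (h : HasSum (fun y : ℕ => Real.exp (-v) * (v : ℝ) ^ y / (y.factorial : ℝ) * g (y + 1)) s) :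
    HasSum (fun y : ℕ => Real.exp (-v) * (v : ℝ) ^ y / (y.factorial : ℝ) * ((y : ℝ) * g y))
      (v * s) := by
  rw [← hasSum_nat_add_iff' 1]
  simp only [Finset.range_one, Finset.sum_singleton, Nat.cast_zero, mul_zero, sub_zero, zero_mul]
  convert! h.mul_left (v : ℝ) using 1
  funext y
  rw [Nat.factorial_succ, pow_succ]
  push_cast
  have : (y.factorial : ℝ) ≠ 0 := by positivity
  have h2 : (y : ℝ) + 1 ≠ 0 := by positivity
  field_simp

lemma hasSum_p1 (v : NNReal) :
    HasSum (fun y : ℕ => Real.exp (-v) * (v : ℝ) ^ y / (y.factorial : ℝ) * (y : ℝ)) v := by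
  have := hasSum_shift v (fun _ => 1) 1 (by simpa using hasSum_p v)
  simpa using this

lemma hasSum_p2 (v : NNReal) :
    HasSum (fun y : ℕ => Real.exp (-v) * (v : ℝ) ^ y / (y.factorial : ℝ) *
      ((y : ℝ) * ((y : ℝ) - 1))) (v * v) := by
  refine hasSum_shift v (fun y => (y : ℝ) - 1) v ?_
  simpa using hasSum_p1 v

/-- The test statistic. -/
noncomputable def T (u : ℝ) (y : ℕ) : ℝ := ((y : ℝ) - u) ^ 2 - y

lemma hasSum_T (u : ℝ) (v : NNReal) :
    HasSum (fun y : ℕ => Real.exp (-v) * (v : ℝ) ^ y / (y.factorial : ℝ) * T u y)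
      ((v - u) ^ 2) := by
  have h := ((hasSum_p2 v).add ((hasSum_p1 v).mul_left (-2 * u))).add ((hasSum_p v).mul_left (u ^ 2))
  convert! h using 1
  · funext y; unfold T; ring
  · ring

lemma integral_T (u : ℝ) (v : NNReal) : ∫ y, T u y ∂(poissonMeasure v) = (v - u) ^ 2 := by
  rw [integral_poissonMeasure]
  exact (hasSum_T u v).tsum_eq

lemma T_sq_le {E u : ℝ} (hu : 0 ≤ u) (huE : u ≤ E) (y : ℕ) :
    (T u y) ^ 2 ≤ ((y : ℝ) + E + 1) ^ 4 := by
  have hy : (0 : ℝ) ≤ y := by positivity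
  have h : |T u y| ≤ ((y : ℝ) + E + 1) ^ 2 := by
    unfold T
    rw [abs_le]
    constructor <;> nlinarith [mul_nonneg hy hu, mul_nonneg hy (sub_nonneg.2 huE), sq_nonneg (E+1), mul_nonneg hu (sub_nonneg.2 huE)]
  calc (T u y) ^ 2 = |T u y| ^ 2 := (sq_abs _).symm
    _ ≤ (((y : ℝ) + E + 1) ^ 2) ^ 2 := by gcongr
    _ = _ := by ring

lemma summable_bound {E : ℝ} (hE : 0 < E) :
    Summable (fun y : ℕ => E ^ y / (y.factorial : ℝ) * ((y : ℝ) + E + 1) ^ 4) := by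
  have h := (Real.summable_pow_div_factorial (E * Real.exp 1)).mul_left (24 * Real.exp (E + 1))
  refine h.of_nonneg_of_le (fun y => by positivity) (fun y => ?_)
  have h4 := Real.pow_div_factorial_le_exp ((y : ℝ) + E + 1) (by positivity) 4
  have h5 : ((y : ℝ) + E + 1) ^ 4 ≤ 24 * Real.exp ((y : ℝ) + E + 1) := by
    rw [div_le_iff₀ (by positivity)] at h4
    have : ((Nat.factorial 4 : ℕ) : ℝ) = 24 := by norm_num [Nat.factorial]
    rw [this] at h4; linarith
  have e : Real.exp ((y : ℝ) + E + 1) = Real.exp 1 ^ y * Real.exp (E + 1) := by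
    rw [← Real.exp_nat_mul, ← Real.exp_add]; congr 1; ring
  calc E ^ y / (y.factorial : ℝ) * ((y : ℝ) + E + 1) ^ 4
      ≤ E ^ y / (y.factorial : ℝ) * (24 * Real.exp ((y : ℝ) + E + 1)) := by gcongr
    _ = _ := by rw [e, mul_pow]; ring

noncomputable def KK (E : ℝ) : ℝ := ∑' y : ℕ, E ^ y / (y.factorial : ℝ) * ((y : ℝ) + E + 1) ^ 4

lemma term_le {E u : ℝ} (hu : 0 ≤ u) (huE : u ≤ E) (v : NNReal) (hv : (v : ℝ) ≤ E) (y : ℕ) :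
    Real.exp (-v) * (v : ℝ) ^ y / (y.factorial : ℝ) * (T u y) ^ 2 ≤
      E ^ y / (y.factorial : ℝ) * ((y : ℝ) + E + 1) ^ 4 := by
  have h1 := T_sq_le hu huE y
  have h2 : Real.exp (-v) * (v : ℝ) ^ y ≤ E ^ y := by
    calc Real.exp (-v) * (v : ℝ) ^ y ≤ 1 * (v : ℝ) ^ y := by
          gcongr; rw [Real.exp_le_one_iff]; simp
      _ ≤ E ^ y := by rw [one_mul]; gcongr
  have hE : 0 ≤ E := hu.trans huE
  gcongr

lemma memLp_T {E u : ℝ} (hE : 0 < E) (hu : 0 ≤ u) (huE : u ≤ E) (v : NNReal) (hv : (v : ℝ) ≤ E) :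
    MemLp (T u) 2 (poissonMeasure v) := by
  rw [memLp_two_iff_integrable_sq (by exact AEStronglyMeasurable.of_discrete)]
  rw [integrable_poissonMeasure_iff]
  refine (summable_bound hE).of_nonneg_of_le (fun y => by positivity) (fun y => ?_)
  rw [Real.norm_of_nonneg (sq_nonneg _)]
  exact term_le hu huE v hv y

lemma variance_T {E u : ℝ} (hE : 0 < E) (hu : 0 ≤ u) (huE : u ≤ E) (v : NNReal)
    (hv : (v : ℝ) ≤ E) : variance (T u) (poissonMeasure v) ≤ KK E := by
  refine (variance_le_expectation_sq (by exact AEStronglyMeasurable.of_discrete)).trans ?_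
  rw [integral_poissonMeasure]
  have hnn : ∀ y : ℕ, 0 ≤ Real.exp (-v) * (v : ℝ) ^ y / (y.factorial : ℝ) * (T u y) ^ 2 :=
    fun y => by positivity
  refine Summable.tsum_le_tsum (fun y => ?_) ?_ (summable_bound hE)
  · exact term_le hu huE v hv y
  · exact (summable_bound hE).of_nonneg_of_le hnn (fun y => term_le hu huE v hv y)

lemma KK_pos {E : ℝ} (hE : 0 < E) : 0 < KK E :=
  (summable_bound hE).tsum_pos (fun y => by positivity) 0 (by positivity)

noncomputable def S {n : ℕ} (u : Fin n → ℝ) (y : Fin n → ℕ) : ℝ := ∑ i, T (u i) (y i)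

/-- Chebyshev for the statistic. -/
lemma cheb {n : ℕ} {E : ℝ} (hE : 0 < E) {u v : Fin n → ℝ} (hu : ∀ i, 0 ≤ u i ∧ u i ≤ E)
    (hv : ∀ i, 0 ≤ v i ∧ v i ≤ E) {c : ℝ} (hc : 0 < c) :
    (mu v).real {y | c ≤ |S u y - ∑ i, (v i - u i) ^ 2|} ≤ n * KK E / c ^ 2 := by
  have hv' : ∀ i, ((v i).toNNReal : ℝ) = v i := fun i => Real.coe_toNNReal _ (hv i).1
  have hm : ∀ i, MemLp (T (u i)) 2 (poissonMeasure (v i).toNNReal) := fun i =>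
    memLp_T hE (hu i).1 (hu i).2 _ (by rw [hv']; exact (hv i).2)
  have hm' : ∀ i, MemLp (fun y : Fin n → ℕ => T (u i) (y i)) 2 (mu v) := fun i =>
    (hm i).comp_measurePreserving (measurePreserving_eval _ i)
  have hS : S u = ∑ i, fun y : Fin n → ℕ => T (u i) (y i) := by
    funext y; simp [S]
  have hSm : MemLp (S u) 2 (mu v) := by
    rw [hS]; exact memLp_finsetSum' _ (fun i _ => hm' i)
  have hmean : ∫ y, S u y ∂(mu v) = ∑ i, (v i - u i) ^ 2 := by
    unfold S
    rw [integral_finsetSum _ (fun i _ => (hm' i).integrable (by norm_num))]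
    refine Finset.sum_congr rfl fun i _ => ?_
    unfold mu
    rw [integral_comp_eval (μ := fun i => poissonMeasure (v i).toNNReal) (i := i) (f := T (u i))
      (AEStronglyMeasurable.of_discrete), integral_T, hv']
  have hvar : variance (S u) (mu v) ≤ n * KK E := by
    rw [hS]; unfold mu
    rw [variance_sum_pi hm]
    calc _ ≤ ∑ i : Fin n, KK E := Finset.sum_le_sum fun i _ =>
          variance_T hE (hu i).1 (hu i).2 _ (by rw [hv']; exact (hv i).2)
      _ = _ := by simp
  have h := meas_ge_le_variance_div_sq hSm hc
  rw [hmean] at h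
  refine (ENNReal.toReal_le_of_le_ofReal (div_nonneg (variance_nonneg _ _) (sq_nonneg _)) h).trans ?_
  gcongr

/-- Separated families of words give codes. -/
lemma code_of_separated {n N : ℕ} {E l1 l2 t : ℝ} (hE : 0 < E) (ht : 0 < t)
    (h1 : n * KK E / t ^ 2 ≤ l1) (h2 : n * KK E / t ^ 2 ≤ l2)
    (u : Fin N → Fin n → ℝ) (hu : ∀ j i, 0 ≤ u j i ∧ u j i ≤ E)
    (hsep : ∀ j k, j ≠ k → 2 * t ≤ ∑ i, (u j i - u k i) ^ 2) :
    poisCode E n N l1 l2 := by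
  refine ⟨u, fun k => {y | S (u k) y < t}, fun j i => (hu j i).1, fun j => ?_, fun j => ?_,
    fun j k hjk => ?_⟩
  · calc _ ≤ ∑ i : Fin n, E := Finset.sum_le_sum fun i _ => (hu j i).2
      _ = _ := by simp
  · rw [pprob_eq (fun i => (hu j i).1)]
    have h := cheb hE (hu j) (hu j) ht
    have e : {y | S (u j) y < t} = {y | t ≤ S (u j) y}ᶜ := by ext y; simp
    show 1 - l1 ≤ (mu (u j)).real {y | S (u j) y < t}
    rw [e, probReal_compl_eq_one_sub MeasurableSet.of_discrete]
    have : (mu (u j)).real {y | t ≤ S (u j) y} ≤ l1 := by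
      refine (measureReal_mono ?_).trans (h.trans h1)
      intro y hy
      simp only [Set.mem_ofPred_eq, sub_self] at hy ⊢
      simpa using hy.trans (le_abs_self _)
    linarith
  · rw [pprob_eq (fun i => (hu j i).1)]
    refine (measureReal_mono ?_).trans ((cheb hE (hu k) (hu j) ht).trans h2)
    intro y hy
    have := hsep j k hjk
    simp only [Set.mem_ofPred_eq] at hy ⊢
    rw [abs_sub_comm]
    refine le_trans ?_ (le_abs_self _)
    linarith

lemma gv (n q d : ℕ) (hq : 0 < q) : ∃ (N : ℕ) (c : Fin N → Fin n → Fin q),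
    (∀ j k, j ≠ k → d + 1 ≤ hammingDist (c j) (c k)) ∧ q ^ n ≤ N * (2 ^ n * q ^ d) := by
  classical
  let P : Finset (Fin n → Fin q) → Prop :=
    fun s => ∀ x ∈ s, ∀ y ∈ s, x ≠ y → d + 1 ≤ hammingDist x y
  obtain ⟨s, hs⟩ : ∃ s, Maximal P s :=
    (Set.toFinite {s | P s}).exists_maximal ⟨∅, by simp [P]⟩
  have hcov : ∀ x, ∃ c ∈ s, hammingDist x c ≤ d := by
    intro x
    by_contra! hx
    have hP : P (insert x s) := by
      intro a ha b hb hab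
      rw [Finset.mem_insert] at ha hb
      rcases ha with rfl | ha <;> rcases hb with rfl | hb
      · exact (hab rfl).elim
      · exact hx b hb
      · rw [hammingDist_comm]; exact hx a ha
      · exact hs.1 a ha b hb hab
    have hxs : x ∈ s := hs.2 hP (Finset.subset_insert _ _) (Finset.mem_insert_self _ _)
    have := hx x hxs
    simp at this
  refine ⟨s.card, fun j => (s.equivFin.symm j : Fin n → Fin q), fun j k hjk => ?_, ?_⟩
  · refine hs.1 _ (s.equivFin.symm j).2 _ (s.equivFin.symm k).2 ?_
    intro h
    exact hjk (s.equivFin.symm.injective (Subtype.ext h))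
  · let Bx : (Fin n → Fin q) → Finset (Fin n) → Finset (Fin n → Fin q) := fun c A =>
      Fintype.piFinset (fun i => if i ∈ A then Finset.univ else {c i})
    have hB : ∀ c (A : Finset (Fin n)), (Bx c A).card = q ^ A.card := by
      intro c A
      simp only [Bx, Fintype.card_piFinset]
      have : ∀ i, (if i ∈ A then (Finset.univ : Finset (Fin q)) else {c i}).card =
          if i ∈ A then q else 1 := by
        intro i; split_ifs <;> simp
      simp only [this]
      rw [Finset.prod_ite_mem, Finset.univ_inter, Finset.prod_const]
    have hsub : (Finset.univ : Finset (Fin n → Fin q)) ⊆ s.biUnion (fun c =>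
        (Finset.univ.filter (fun A : Finset (Fin n) => A.card ≤ d)).biUnion (Bx c)) := by
      intro x _
      obtain ⟨c, hc, hxc⟩ := hcov x
      rw [Finset.mem_biUnion]
      refine ⟨c, hc, ?_⟩
      rw [Finset.mem_biUnion]
      refine ⟨Finset.univ.filter (fun i => x i ≠ c i), ?_, ?_⟩
      · simp only [Finset.mem_filter, Finset.mem_univ, true_and]
        exact hxc
      · simp only [Bx, Fintype.mem_piFinset]
        intro i
        by_cases h : x i = c i <;> simp [h]
    have h1 : q ^ n = (Finset.univ : Finset (Fin n → Fin q)).card := by simp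
    rw [h1]
    refine (Finset.card_le_card hsub).trans ?_
    refine Finset.card_biUnion_le_card_mul _ _ _ fun c _ => ?_
    refine (Finset.card_biUnion_le_card_mul _ _ (q ^ d) fun A hA => ?_).trans ?_
    · rw [hB]
      exact Nat.pow_le_pow_right hq (Finset.mem_filter.1 hA).2
    · gcongr
      refine (Finset.card_filter_le _ _).trans ?_
      simp

lemma packing {n N : ℕ} (p : Fin N → EuclideanSpace ℝ (Fin n)) {R c : ℝ} (hR : 0 ≤ R)
    (hc : 0 < c) (hp : ∀ j, ‖p j‖ ≤ R) (hsep : ∀ j k, j ≠ k → 2 * c ≤ dist (p j) (p k)) :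
    (N : ℝ) * c ^ n ≤ (R + c) ^ n := by
  have hdisj : Pairwise (Function.onFun Disjoint fun j => Metric.ball (p j) c) := by
    intro j k hjk
    exact Metric.ball_disjoint_ball (by linarith [hsep j k hjk])
  have hsub : (⋃ j, Metric.ball (p j) c) ⊆ Metric.ball 0 (R + c) := by
    refine Set.iUnion_subset fun j => Metric.ball_subset_ball' ?_
    rw [dist_zero_right]; linarith [hp j]
  have h := MeasureTheory.measure_mono (μ := (volume : Measure (EuclideanSpace ℝ (Fin n)))) hsub
  rw [measure_iUnion hdisj (fun j => measurableSet_ball), tsum_fintype] at h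
  have hb : ∀ (x : EuclideanSpace ℝ (Fin n)) (r : ℝ), 0 < r →
      (volume : Measure (EuclideanSpace ℝ (Fin n))) (Metric.ball x r) = ENNReal.ofReal (r ^ n) *
        (volume : Measure (EuclideanSpace ℝ (Fin n))) (Metric.ball 0 1) := by
    intro x r hr
    rw [Measure.addHaar_ball_of_pos _ _ hr]; simp
  simp only [hb _ c hc, hb _ (R + c) (by linarith)] at h
  rw [Finset.sum_const, nsmul_eq_mul, ← mul_assoc] at h
  have hne : (volume : Measure (EuclideanSpace ℝ (Fin n))) (Metric.ball 0 1) ≠ 0 :=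
    (Metric.measure_ball_pos _ _ one_pos).ne'
  have hnt : (volume : Measure (EuclideanSpace ℝ (Fin n))) (Metric.ball 0 1) ≠ ⊤ :=
    measure_ball_lt_top.ne
  rw [ENNReal.mul_le_mul_iff_left hne hnt] at h
  simp only [Finset.card_univ, Fintype.card_fin] at h
  rw [← ENNReal.ofReal_natCast, ← ENNReal.ofReal_mul (by positivity)] at h
  exact (ENNReal.ofReal_le_ofReal_iff (by positivity)).1 h

lemma upper {E l1 l2 : ℝ} (hE : 0 < E) (h12 : l1 + l2 < 1) :
    ∃ C : ℝ, ∀ n : ℕ, 1 ≤ n → ∀ N : ℕ, 1 ≤ N → poisCode E n N l1 l2 →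
      Real.log N ≤ n * (1 / 2 * Real.log n + C) := by
  set η := 1 - l1 - l2 with hη
  have hη0 : 0 < η := by linarith
  refine ⟨Real.log (4 * √E / η + 1), fun n hn N hN ⟨u, D, hu, hpow, hd1, hd2⟩ => ?_⟩
  let p : Fin N → EuclideanSpace ℝ (Fin n) := fun j => WithLp.toLp 2 (fun i => √(u j i))
  have hn1 : (1 : ℝ) ≤ n := by exact_mod_cast hn
  have hpk := packing p (R := √(n * E)) (c := η / 4) (by positivity) (by positivity) ?_ ?_
  · have h1 : (N : ℝ) ≤ ((4 * √E / η + 1) * √n) ^ n := by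
      have h2 : (N : ℝ) ≤ ((√(n * E) + η / 4) / (η / 4)) ^ n := by
        rw [div_pow, le_div_iff₀ (by positivity)]; exact hpk
      refine h2.trans ?_
      refine pow_le_pow_left₀ (by positivity) ?_ n
      rw [Real.sqrt_mul (by positivity)]
      have : (√n * √E + η / 4) / (η / 4) = 4 * √E / η * √n + 1 := by field_simp
      rw [this, add_mul, one_mul]
      have : 1 ≤ √(n : ℝ) := Real.one_le_sqrt.2 hn1
      linarith
    have h3 := Real.log_le_log (by positivity) h1
    rw [Real.log_pow, Real.log_mul (by positivity) (by positivity), Real.log_sqrt (by positivity)] at h3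
    linarith
  · intro j
    rw [EuclideanSpace.norm_eq]
    apply Real.sqrt_le_sqrt
    refine le_trans (le_of_eq ?_) (hpow j)
    refine Finset.sum_congr rfl fun i _ => ?_
    simp [p, Real.sq_sqrt (hu j i)]
  · intro j k hjk
    rw [EuclideanSpace.dist_eq]
    apply Real.le_sqrt_of_sq_le
    have h := separation (hu j) (hu k) (D j) hη0 (by linarith [hd1 j, hd2 k j hjk.symm])
    refine le_trans (by apply le_of_eq; ring) (h.trans (le_of_eq ?_))
    refine Finset.sum_congr rfl fun i _ => ?_
    simp [p, Real.dist_eq]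

lemma lower {E l1 l2 : ℝ} (hE : 0 < E) (h1 : 0 < l1) (h2 : 0 < l2) {ε : ℝ} (hε : 0 < ε)
    (hε1 : ε < 1) :
    ∃ C : ℝ, ∀ n : ℕ, 1 ≤ n → ∃ N : ℕ, 1 ≤ N ∧ poisCode E n N l1 l2 ∧
      n * ((1 - ε) / 4 * Real.log n + C) ≤ Real.log N := by
  set l := min l1 l2 with hl
  have hl0 : 0 < l := lt_min h1 h2
  have hK := KK_pos hE
  set B2 := 2 * √(KK E / l) / ε with hB2
  have hB2' : 0 < B2 := by positivity
  refine ⟨(1 - ε) * Real.log (E / √B2) - Real.log 2, fun n hn => ?_⟩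
  have hn0 : (0 : ℝ) < n := by exact_mod_cast hn
  set t := √(KK E / l) * √n with ht
  have ht0 : 0 < t := by positivity
  set a := √(B2 / √n) with ha
  have ha0 : 0 < a := by positivity
  have hasq : a ^ 2 = B2 / √n := Real.sq_sqrt (by positivity)
  set d := ⌊ε * n⌋₊ with hd
  have hd1 : (d : ℝ) ≤ ε * n := Nat.floor_le (by positivity)
  have hd2 : ε * n < d + 1 := Nat.lt_floor_add_one _
  set q := ⌊E / a⌋₊ + 1 with hq
  have hq1 : E / a < q := by rw [hq]; push_cast; exact Nat.lt_floor_add_one _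
  have hqf : (⌊E / a⌋₊ : ℝ) ≤ E / a := Nat.floor_le (by positivity)
  obtain ⟨N, c, hc, hN⟩ := gv n q d (Nat.succ_pos _)
  have hN1 : 1 ≤ N := by
    by_contra h
    have : N = 0 := by omega
    subst this
    have : 0 < q ^ n := Nat.pow_pos (Nat.succ_pos _)
    omega
  have hsn : √(n : ℝ) * √n = n := Real.mul_self_sqrt hn0.le
  have hKt : n * KK E / t ^ 2 = l := by
    rw [ht, mul_pow, Real.sq_sqrt (by positivity), Real.sq_sqrt (by positivity)]
    field_simp
  refine ⟨N, hN1, ?_, ?_⟩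
  · refine code_of_separated hE ht0 (hKt.le.trans (min_le_left _ _))
      (hKt.le.trans (min_le_right _ _)) (fun j i => a * ((c j i : ℕ) : ℝ)) (fun j i => ⟨by positivity, ?_⟩) ?_
    · have h3 : ((c j i : ℕ) : ℝ) ≤ E / a := by
        refine le_trans ?_ hqf
        exact_mod_cast Nat.lt_succ_iff.1 (c j i).2
      rw [le_div_iff₀ ha0] at h3
      linarith
    · intro j k hjk
      have h3 : (d : ℝ) + 1 ≤ hammingDist (c j) (c k) := by exact_mod_cast hc j k hjk
      have h4 : a ^ 2 * (hammingDist (c j) (c k) : ℝ) ≤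
          ∑ i, (a * ((c j i : ℕ) : ℝ) - a * ((c k i : ℕ) : ℝ)) ^ 2 := by
        rw [hammingDist, Finset.card_eq_sum_ones, Nat.cast_sum, Finset.mul_sum, Finset.sum_filter]
        refine Finset.sum_le_sum fun i _ => ?_
        split_ifs with h
        · rw [← mul_sub, mul_pow]
          have h5 : (1 : ℝ) ≤ (((c j i : ℕ) : ℝ) - ((c k i : ℕ) : ℝ)) ^ 2 := by
            have h6 : ((c j i : ℕ) : ℤ) - ((c k i : ℕ) : ℤ) ≠ 0 := by
              intro h7
              apply h
              apply Fin.ext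
              omega
            have h8 : (1 : ℤ) ≤ (((c j i : ℕ) : ℤ) - ((c k i : ℕ) : ℤ)) ^ 2 :=
              Int.add_one_le_iff.2 (sq_pos_of_ne_zero h6)
            exact_mod_cast h8
          push_cast
          gcongr
        · positivity
      refine le_trans ?_ h4
      calc 2 * t = a ^ 2 * (ε * n) := by
            rw [hasq, hB2, ht]
            have hs0 : √(n : ℝ) ≠ 0 := by positivity
            calc 2 * (√(KK E / l) * √n) = 2 * √(KK E / l) / ε / √n * (ε * (√n * √n)) := by
                  field_simp
              _ = _ := by rw [hsn]
        _ ≤ _ := by gcongr; linarith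
  · have hqpos : (0 : ℝ) < q := by rw [hq]; positivity
    have hlq0 : 0 ≤ Real.log q := Real.log_nonneg (by rw [hq]; push_cast; linarith [Nat.cast_nonneg (α := ℝ) ⌊E / a⌋₊])
    have hNr : (q : ℝ) ^ n ≤ N * (2 ^ n * q ^ d) := by exact_mod_cast hN
    have hNpos : (0 : ℝ) < N := by exact_mod_cast hN1
    have h3 := Real.log_le_log (by positivity) hNr
    rw [Real.log_mul (by positivity) (by positivity), Real.log_mul (by positivity) (by positivity),
      Real.log_pow, Real.log_pow, Real.log_pow] at h3
    have h4 : Real.log (E / √B2) + 1 / 4 * Real.log n ≤ Real.log q := by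
      have h5 := Real.log_le_log (by positivity) hq1.le
      refine le_trans (le_of_eq ?_) h5
      clear_value B2
      rw [ha, Real.log_div (by positivity) (by positivity), Real.log_div (by positivity) (by positivity),
        Real.log_sqrt (by positivity), Real.log_sqrt (by positivity), Real.log_div (by positivity) (by positivity),
        Real.log_sqrt (by positivity)]
      ring
    have h6 : (d : ℝ) * Real.log q ≤ ε * n * Real.log q := by gcongr
    have h7 : (1 - ε) * n * (Real.log (E / √B2) + 1 / 4 * Real.log n) ≤ (1 - ε) * n * Real.log q := by
      apply mul_le_mul_of_nonneg_left h4
      have : 0 < 1 - ε := by linarith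
      positivity
    nlinarith

end PoisAux

/-- Theorem (DI capacity bounds for the discrete-time Poisson channel with average power
constraint `E > 0`): `1/4 ≤ liminf log₂ N(n)/(n log₂ n)` and
`limsup log₂ N(n)/(n log₂ n) ≤ 1/2` for the maximal code sizes `N n`. -/
theorem stmt10 (En : ℝ) (hE : 0 < En)
    (l1 l2 : ℝ) (h1 : 0 < l1) (h2 : 0 < l2) (h12 : l1 + l2 < 1)
    (N : ℕ → ℕ) (hN : ∀ n, IsGreatest {m : ℕ | poisCode En n m l1 l2} (N n)) :
    (1 / 4 : ℝ) ≤
        Filter.liminf (fun n : ℕ =>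
          Real.logb 2 (N n) / ((n : ℝ) * Real.logb 2 n)) Filter.atTop ∧
      Filter.limsup (fun n : ℕ =>
          Real.logb 2 (N n) / ((n : ℝ) * Real.logb 2 n)) Filter.atTop ≤ (1 / 2 : ℝ) := by
  have hf : (fun n : ℕ => Real.logb 2 (N n) / ((n : ℝ) * Real.logb 2 n)) =
      fun n : ℕ => Real.log (N n) / ((n : ℝ) * Real.log n) := by
    funext n
    have : Real.log 2 ≠ 0 := (Real.log_pos one_lt_two).ne'
    simp only [Real.logb]
    rw [← mul_div_assoc, div_div_div_cancel_right₀ this]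
  rw [hf]
  have hlog : Tendsto (fun n : ℕ => Real.log (n : ℝ)) atTop atTop :=
    Real.tendsto_log_atTop.comp tendsto_natCast_atTop_atTop
  have hsmall : ∀ C ε : ℝ, 0 < ε → ∀ᶠ n : ℕ in atTop, |C / Real.log n| < ε := by
    intro C ε hε
    have := (hlog.const_div_atTop C)
    have h := (Metric.tendsto_nhds.1 this) ε hε
    filter_upwards [h] with n hn
    rwa [dist_zero_right, Real.norm_eq_abs] at hn
  have hlo : ∀ ε : ℝ, 0 < ε → ε < 1 → ∀ᶠ n : ℕ in atTop,
      1 / 4 - ε ≤ Real.log (N n) / ((n : ℝ) * Real.log n) := by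
    intro ε hε hε1
    obtain ⟨C, hC⟩ := PoisAux.lower hE h1 h2 hε hε1
    filter_upwards [hsmall C (3 / 4 * ε) (by positivity), hlog.eventually_gt_atTop 0,
      eventually_ge_atTop 1] with n hs hl hn
    obtain ⟨M, hM1, hMc, hM⟩ := hC n hn
    have hMN : M ≤ N n := (hN n).2 hMc
    have hn0 : (0 : ℝ) < n := by exact_mod_cast hn
    have h3 : Real.log M ≤ Real.log (N n) :=
      Real.log_le_log (by exact_mod_cast hM1) (by exact_mod_cast hMN)
    rw [le_div_iff₀ (by positivity)]
    refine le_trans ?_ (hM.trans h3)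
    have h4 := (abs_lt.1 hs).1
    rw [lt_div_iff₀ hl] at h4
    nlinarith
  have hup : ∀ ε : ℝ, 0 < ε → ∀ᶠ n : ℕ in atTop,
      Real.log (N n) / ((n : ℝ) * Real.log n) ≤ 1 / 2 + ε := by
    intro ε hε
    obtain ⟨C, hC⟩ := PoisAux.upper (l1 := l1) (l2 := l2) hE h12
    filter_upwards [hsmall C ε hε, hlog.eventually_gt_atTop 0,
      eventually_ge_atTop 1] with n hs hl hn
    have hn0 : (0 : ℝ) < n := by exact_mod_cast hn
    rw [div_le_iff₀ (by positivity)]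
    have h4 := (abs_lt.1 hs).2
    rw [div_lt_iff₀ hl] at h4
    rcases Nat.eq_zero_or_pos (N n) with h0 | h0
    · rw [h0]; simp; positivity
    · refine (hC n hn (N n) h0 (hN n).1).trans ?_
      nlinarith
  have hbu : IsBoundedUnder (· ≤ ·) atTop
      (fun n : ℕ => Real.log (N n) / ((n : ℝ) * Real.log n)) := ⟨1 / 2 + 1, hup 1 one_pos⟩
  have hbl : IsBoundedUnder (· ≥ ·) atTop
      (fun n : ℕ => Real.log (N n) / ((n : ℝ) * Real.log n)) :=
    ⟨1 / 4 - 1 / 2, hlo (1 / 2) (by norm_num) (by norm_num)⟩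
  constructor
  · refine le_of_forall_pos_sub_le fun ε hε => ?_
    have hm : 0 < min ε (1 / 2) := lt_min hε (by norm_num)
    have := le_liminf_of_le hbu.isCoboundedUnder_ge
      (hlo (min ε (1 / 2)) hm ((min_le_right _ _).trans_lt (by norm_num)))
    linarith [min_le_left ε (1 / 2)]
  · refine le_of_forall_pos_le_add fun ε hε => ?_
    exact limsup_le_of_le hbl.isCoboundedUnder_le (hup ε hε)
end

section
/- Let W be a channel with arbitrary input alphabet 𝒳 and finite output alphabet 𝒴, and let √X̃ = { (√(W_x(y)))_{y∈𝒴} : x ∈ 𝒳 } ⊆ ℝ^𝒴 with the Euclidean metric. Then for every λ₁, λ₂ > 0 with λ₁ + λ₂ < 1, (1/4) · d̄_M(√X̃) ≤ limsup_{n→∞} (1/(n log₂ n)) · log₂ N_DI(n,λ₁,λ₂) ≤ (1/2) · d̄_M(√X̃), where d̄_M denotes the upper Minkowski dimension. -/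
open Real Filter

namespace DIChannel

variable {X Y : Type*}

/-- `p` is a probability distribution on the finite alphabet `Y`. -/
def IsDist [Fintype Y] (p : Y → ℝ) : Prop := (∀ y, 0 ≤ p y) ∧ ∑ y, p y = 1

/-- Product (memoryless) output distribution `W_{x^n}` on `Y^n`. -/
noncomputable def prodP [Fintype Y] (W : X → Y → ℝ) {n : ℕ} (u : Fin n → X)
    (y : Fin n → Y) : ℝ := ∏ i, W (u i) (y i)

/-- Probability of a set of output words under `W_{x^n}`. -/
noncomputable def probOf [Fintype Y] (W : X → Y → ℝ) {n : ℕ} (u : Fin n → X)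
    (E : Finset (Fin n → Y)) : ℝ := ∑ y ∈ E, prodP W u y

/-- An `(n,N,λ₁,λ₂)`-deterministic identification code for the channel `W`. -/
def diCode [Fintype Y] (W : X → Y → ℝ) (n N : ℕ) (l1 l2 : ℝ) : Prop :=
  ∃ (u : Fin N → Fin n → X) (E : Fin N → Finset (Fin n → Y)),
    (∀ j, 1 - l1 ≤ probOf W (u j) (E j)) ∧
    (∀ j k, j ≠ k → probOf W (u j) (E k) ≤ l2)

/-- The spherisation `√X̃ = {(√W_x(y))_y : x ∈ 𝒳} ⊆ ℝ^𝒴` of the output set, carrying the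
Euclidean metric. -/
noncomputable def sqrtSet [Fintype Y] (W : X → Y → ℝ) : Set (EuclideanSpace ℝ Y) :=
  {v | ∃ x : X, ∀ y, v y = Real.sqrt (W x y)}

/-- Covering number `Γ_δ(F)`: the minimal number of closed balls of radius `δ` with centers
in `F` whose union contains `F`; `⊤` if no finite such cover exists. -/
noncomputable def coverNum {α : Type*} [PseudoMetricSpace α] (F : Set α) (δ : ℝ) : ℕ∞ :=
  sInf {n : ℕ∞ | ∃ s : Finset α, ↑s ⊆ F ∧ (s.card : ℕ∞) = n ∧
    F ⊆ ⋃ x ∈ s, Metric.closedBall x δ}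

/-- Packing number `Π_δ(F)`: the maximal number of pairwise disjoint open balls of radius `δ`
with centers in `F`. -/
noncomputable def packNum {α : Type*} [PseudoMetricSpace α] (F : Set α) (δ : ℝ) : ℕ∞ :=
  sSup {n : ℕ∞ | ∃ s : Finset α, ↑s ⊆ F ∧ (s.card : ℕ∞) = n ∧
    (↑s : Set α).PairwiseDisjoint fun x => Metric.ball x δ}

/-- Lower Minkowski dimension `d̲_M(F) = liminf_{δ→0⁺} log Γ_δ(F)/(−log δ)`. -/
noncomputable def lowerMinkDim {α : Type*} [PseudoMetricSpace α] (F : Set α) : ℝ :=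
  Filter.liminf (fun δ : ℝ => Real.log ((coverNum F δ).toNat : ℝ) / (-Real.log δ))
    (nhdsWithin 0 (Set.Ioi 0))

/-- Upper Minkowski dimension `d̄_M(F) = limsup_{δ→0⁺} log Γ_δ(F)/(−log δ)`. -/
noncomputable def upperMinkDim {α : Type*} [PseudoMetricSpace α] (F : Set α) : ℝ :=
  Filter.limsup (fun δ : ℝ => Real.log ((coverNum F δ).toNat : ℝ) / (-Real.log δ))
    (nhdsWithin 0 (Set.Ioi 0))

end DIChannel

open DIChannel

/-- squared Hellinger-type distance between two output distributions -/
noncomputable def hel {X Y : Type*} [Fintype Y] (W : X → Y → ℝ) (x x' : X) : ℝ :=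
  ∑ y, (√(W x y) - √(W x' y)) ^ 2

/-- negative entropy -/
noncomputable def negEnt {X Y : Type*} [Fintype Y] (W : X → Y → ℝ) (x : X) : ℝ :=
  ∑ y, W x y * Real.log (W x y)

section prob

variable {X Y : Type*} [Fintype Y]

theorem hel_nonneg (W : X → Y → ℝ) (x x' : X) : 0 ≤ hel W x x' :=
  Finset.sum_nonneg fun _ _ => sq_nonneg _

theorem sum_prod_eq {n : ℕ} (f : Fin n → Y → ℝ) :
    ∑ y : Fin n → Y, ∏ i, f i (y i) = ∏ i, ∑ y, f i y := by
  rw [Finset.prod_univ_sum, Fintype.piFinset_univ]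

theorem prodP_nonneg {W : X → Y → ℝ} (hW : ∀ x, IsDist (W x)) {n : ℕ} (u : Fin n → X)
    (y : Fin n → Y) : 0 ≤ prodP W u y :=
  Finset.prod_nonneg fun i _ => (hW _).1 _

theorem prodP_sum {W : X → Y → ℝ} (hW : ∀ x, IsDist (W x)) {n : ℕ} (u : Fin n → X) :
    ∑ y, prodP W u y = 1 := by
  unfold prodP
  rw [sum_prod_eq (fun i y => W (u i) y)]
  exact Finset.prod_eq_one fun i _ => (hW _).2

theorem bhat_one {W : X → Y → ℝ} (hW : ∀ x, IsDist (W x)) (x x' : X) :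
    ∑ y, √(W x y) * √(W x' y) = 1 - hel W x x' / 2 := by
  have h : hel W x x' = ∑ y, (W x y + W x' y - 2 * (√(W x y) * √(W x' y))) := by
    unfold hel
    refine Finset.sum_congr rfl fun y _ => ?_
    have e1 := Real.sq_sqrt ((hW x).1 y)
    have e2 := Real.sq_sqrt ((hW x').1 y)
    nlinarith
  rw [h, Finset.sum_sub_distrib, Finset.sum_add_distrib, (hW x).2, (hW x').2, ← Finset.mul_sum]
  ring

theorem bhat_prod {W : X → Y → ℝ} (hW : ∀ x, IsDist (W x)) {n : ℕ} (u v : Fin n → X) :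
    ∑ y, √(prodP W u y) * √(prodP W v y) = ∏ i, (1 - hel W (u i) (v i) / 2) := by
  have : ∀ y : Fin n → Y, √(prodP W u y) * √(prodP W v y)
      = ∏ i, (√(W (u i) (y i)) * √(W (v i) (y i))) := by
    intro y
    unfold prodP
    rw [Real.sqrt_prod _ (fun i _ => (hW _).1 _), Real.sqrt_prod _ (fun i _ => (hW _).1 _),
      Finset.prod_mul_distrib]
  simp_rw [this]
  rw [sum_prod_eq (fun i y => √(W (u i) y) * √(W (v i) y))]
  exact Finset.prod_congr rfl fun i _ => bhat_one hW _ _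

theorem hel_le_two {W : X → Y → ℝ} (hW : ∀ x, IsDist (W x)) (x x' : X) : hel W x x' / 2 ≤ 1 := by
  have h := bhat_one hW x x'
  have : 0 ≤ ∑ y, √(W x y) * √(W x' y) := Finset.sum_nonneg fun _ _ => by positivity
  linarith

theorem one_sub_sum_le_prod_aux {ι : Type*} (s : Finset ι) (f : ι → ℝ) (h0 : ∀ i, 0 ≤ f i)
    (h1 : ∀ i, f i ≤ 1) : 1 - ∑ i ∈ s, f i ≤ ∏ i ∈ s, (1 - f i) := by
  classical
  induction s using Finset.induction_on with
  | empty => simp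
  | insert a s ha ih =>
    rw [Finset.sum_insert ha, Finset.prod_insert ha]
    have hp : ∏ i ∈ s, (1 - f i) ≤ 1 :=
      Finset.prod_le_one (fun i _ => by linarith [h1 i]) (fun i _ => by linarith [h0 i])
    nlinarith [h0 a, h1 a]

theorem bhat_ge {W : X → Y → ℝ} (hW : ∀ x, IsDist (W x)) {n : ℕ} (u v : Fin n → X) :
    1 - (∑ i, hel W (u i) (v i)) / 2 ≤ ∑ y, √(prodP W u y) * √(prodP W v y) := by
  rw [bhat_prod hW, Finset.sum_div]
  exact one_sub_sum_le_prod_aux _ _ (fun i => by have := hel_nonneg W (u i) (v i); positivity)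
    (fun i => hel_le_two hW _ _)

theorem bhat_le {W : X → Y → ℝ} (hW : ∀ x, IsDist (W x)) {n : ℕ} (u v : Fin n → X) :
    ∑ y, √(prodP W u y) * √(prodP W v y) ≤ Real.exp (-(∑ i, hel W (u i) (v i)) / 2) := by
  rw [bhat_prod hW, neg_div, Finset.sum_div, ← Finset.sum_neg_distrib, Real.exp_sum]
  refine Finset.prod_le_prod (fun i _ => by linarith [hel_le_two hW (u i) (v i)]) fun i _ => ?_
  have := Real.add_one_le_exp (-(hel W (u i) (v i) / 2))
  linarith

/-- distinguishability forces Hellinger distance -/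
theorem tau_le {W : X → Y → ℝ} (hW : ∀ x, IsDist (W x)) {n : ℕ} (u v : Fin n → X)
    (E : Finset (Fin n → Y)) :
    (probOf W u E - probOf W v E) ^ 2 ≤ 4 * ∑ i, hel W (u i) (v i) := by
  have e : probOf W u E - probOf W v E =
      ∑ y ∈ E, (√(prodP W u y) - √(prodP W v y)) * (√(prodP W u y) + √(prodP W v y)) := by
    unfold probOf
    rw [← Finset.sum_sub_distrib]
    refine Finset.sum_congr rfl fun y _ => ?_
    have e1 := Real.sq_sqrt (prodP_nonneg hW u y)
    have e2 := Real.sq_sqrt (prodP_nonneg hW v y)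
    nlinarith
  rw [e]
  refine (Finset.sum_mul_sq_le_sq_mul_sq _ _ _).trans ?_
  have hA : ∑ y ∈ E, (√(prodP W u y) - √(prodP W v y)) ^ 2 ≤ ∑ i, hel W (u i) (v i) := by
    refine (Finset.sum_le_univ_sum_of_nonneg fun y => sq_nonneg _).trans ?_
    have h : ∑ y, (√(prodP W u y) - √(prodP W v y)) ^ 2 =
        ∑ y, (prodP W u y + prodP W v y - 2 * (√(prodP W u y) * √(prodP W v y))) := by
      refine Finset.sum_congr rfl fun y _ => ?_
      have e1 := Real.sq_sqrt (prodP_nonneg hW u y)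
      have e2 := Real.sq_sqrt (prodP_nonneg hW v y)
      nlinarith
    rw [h, Finset.sum_sub_distrib, Finset.sum_add_distrib, prodP_sum hW, prodP_sum hW,
      ← Finset.mul_sum]
    linarith [bhat_ge hW u v]
  have hB : ∑ y ∈ E, (√(prodP W u y) + √(prodP W v y)) ^ 2 ≤ 4 := by
    refine (Finset.sum_le_univ_sum_of_nonneg fun y => sq_nonneg _).trans ?_
    have h : ∑ y, (√(prodP W u y) + √(prodP W v y)) ^ 2 ≤
        ∑ y, (2 * prodP W u y + 2 * prodP W v y) := by
      refine Finset.sum_le_sum fun y _ => ?_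
      have e1 := Real.sq_sqrt (prodP_nonneg hW u y)
      have e2 := Real.sq_sqrt (prodP_nonneg hW v y)
      nlinarith [sq_nonneg (√(prodP W u y) - √(prodP W v y))]
    rw [Finset.sum_add_distrib, ← Finset.mul_sum, ← Finset.mul_sum, prodP_sum hW,
      prodP_sum hW] at h
    linarith
  have h0 : 0 ≤ ∑ y ∈ E, (√(prodP W u y) - √(prodP W v y)) ^ 2 :=
    Finset.sum_nonneg fun _ _ => sq_nonneg _
  have h1 : 0 ≤ ∑ y ∈ E, (√(prodP W u y) + √(prodP W v y)) ^ 2 :=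
    Finset.sum_nonneg fun _ _ => sq_nonneg _
  nlinarith

/-! ### second moments -/

theorem W_le_one {W : X → Y → ℝ} (hW : ∀ x, IsDist (W x)) (x : X) (y : Y) : W x y ≤ 1 := by
  rw [← (hW x).2]
  exact Finset.single_le_sum (fun i _ => (hW x).1 i) (Finset.mem_univ y)

theorem mul_log_sq_le {p : ℝ} (h0 : 0 ≤ p) (h1 : p ≤ 1) : p * Real.log p ^ 2 ≤ 4 := by
  rcases h0.eq_or_lt with rfl | h0
  · simp
  have h := Real.abs_log_mul_self_lt (√p) (Real.sqrt_pos.2 h0) (Real.sqrt_le_one.2 h1)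
  rw [Real.log_sqrt h0.le] at h
  have h2 : (Real.log p / 2 * √p) ^ 2 < 1 := (sq_lt_one_iff_abs_lt_one _).2 h
  rw [mul_pow, Real.sq_sqrt h0.le] at h2
  nlinarith

theorem mul_log_ge {p : ℝ} (h0 : 0 ≤ p) (h1 : p ≤ 1) : -1 ≤ p * Real.log p := by
  rcases h0.eq_or_lt with rfl | h0
  · simp
  have h := Real.abs_log_mul_self_lt p h0 h1
  have := (abs_lt.1 h).1
  linarith

theorem negEnt_le {W : X → Y → ℝ} (hW : ∀ x, IsDist (W x)) (x : X) : negEnt W x ≤ 0 :=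
  Finset.sum_nonpos fun y _ => mul_nonpos_of_nonneg_of_nonpos ((hW x).1 y)
    (Real.log_nonpos ((hW x).1 y) (W_le_one hW x y))

theorem negEnt_ge {W : X → Y → ℝ} (hW : ∀ x, IsDist (W x)) (x : X) :
    -(Fintype.card Y : ℝ) ≤ negEnt W x := by
  have : ∑ _y : Y, (-1 : ℝ) ≤ negEnt W x :=
    Finset.sum_le_sum fun y _ => mul_log_ge ((hW x).1 y) (W_le_one hW x y)
  simpa using this

/-- centred log-likelihood -/
noncomputable def cen (W : X → Y → ℝ) (x : X) (y : Y) : ℝ := Real.log (W x y) - negEnt W x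

theorem cen_mean {W : X → Y → ℝ} (hW : ∀ x, IsDist (W x)) (x : X) :
    ∑ y, W x y * cen W x y = 0 := by
  unfold cen
  simp_rw [mul_sub]
  rw [Finset.sum_sub_distrib, ← Finset.sum_mul, (hW x).2]
  unfold negEnt
  ring

theorem cen_var {W : X → Y → ℝ} (hW : ∀ x, IsDist (W x)) (x : X) :
    ∑ y, W x y * cen W x y ^ 2 ≤ 4 * Fintype.card Y := by
  have e : ∑ y, W x y * cen W x y ^ 2 = ∑ y, W x y * Real.log (W x y) ^ 2 - negEnt W x ^ 2 := by
    have : ∀ y, W x y * cen W x y ^ 2 = W x y * Real.log (W x y) ^ 2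
        - 2 * negEnt W x * (W x y * Real.log (W x y)) + negEnt W x ^ 2 * W x y := by
      intro y; unfold cen; ring
    simp_rw [this]
    rw [Finset.sum_add_distrib, Finset.sum_sub_distrib, ← Finset.mul_sum, ← Finset.mul_sum,
      (hW x).2]
    change _ - 2 * negEnt W x * negEnt W x + _ = _
    ring
  have h : ∑ y, W x y * Real.log (W x y) ^ 2 ≤ ∑ _y : Y, (4 : ℝ) :=
    Finset.sum_le_sum fun y _ => mul_log_sq_le ((hW x).1 y) (W_le_one hW x y)
  rw [Finset.sum_const, Finset.card_univ, nsmul_eq_mul] at h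
  rw [e]
  nlinarith [sq_nonneg (negEnt W x)]

theorem cross_moment {W : X → Y → ℝ} (hW : ∀ x, IsDist (W x)) {n : ℕ} (u : Fin n → X)
    (i j : Fin n) :
    ∑ y, prodP W u y * (cen W (u i) (y i) * cen W (u j) (y j)) ≤
      if i = j then 4 * (Fintype.card Y : ℝ) else 0 := by
  have hs : ∀ y : Fin n → Y, prodP W u y * (cen W (u i) (y i) * cen W (u j) (y j)) =
      ∏ k, (W (u k) (y k) * ((if k = i then cen W (u k) (y k) else 1) *
        (if k = j then cen W (u k) (y k) else 1))) := by
    intro y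
    rw [Finset.prod_mul_distrib, Finset.prod_mul_distrib]
    simp [prodP]
  simp_rw [hs]
  rw [sum_prod_eq (fun k y => (W (u k) y * ((if k = i then cen W (u k) y else 1) *
        (if k = j then cen W (u k) y else 1))))]
  split_ifs with hij
  · subst hij
    rw [Finset.prod_eq_single i]
    · simp only [if_true]
      simpa [sq] using cen_var hW (u i)
    · intro b _ hb
      simp [hb, (hW (u b)).2]
    · simp
  · apply le_of_eq
    apply Finset.prod_eq_zero (Finset.mem_univ i)
    simp [hij, cen_mean hW]

theorem second_moment {W : X → Y → ℝ} (hW : ∀ x, IsDist (W x)) {n : ℕ} (u : Fin n → X) :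
    ∑ y, prodP W u y * (∑ i, cen W (u i) (y i)) ^ 2 ≤ n * (4 * Fintype.card Y) := by
  have hs : ∀ y : Fin n → Y, prodP W u y * (∑ i, cen W (u i) (y i)) ^ 2 =
      ∑ i, ∑ j, prodP W u y * (cen W (u i) (y i) * cen W (u j) (y j)) := by
    intro y
    rw [sq, Finset.sum_mul_sum, Finset.mul_sum]
    simp_rw [Finset.mul_sum]
  simp_rw [hs]
  rw [Finset.sum_comm]
  have : ∀ i, ∑ y, ∑ j, prodP W u y * (cen W (u i) (y i) * cen W (u j) (y j))
      ≤ 4 * Fintype.card Y := by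
    intro i
    rw [Finset.sum_comm]
    refine (Finset.sum_le_sum fun j _ => cross_moment hW u i j).trans ?_
    simp
  refine (Finset.sum_le_sum fun i _ => this i).trans ?_
  simp

theorem prodP_eq_exp {W : X → Y → ℝ} (hW : ∀ x, IsDist (W x)) {n : ℕ} (u : Fin n → X)
    (y : Fin n → Y) (h : prodP W u y ≠ 0) :
    prodP W u y = Real.exp (∑ i, cen W (u i) (y i) + ∑ i, negEnt W (u i)) := by
  rw [← Finset.sum_add_distrib, Real.exp_sum]
  unfold prodP at *
  refine Finset.prod_congr rfl fun i _ => ?_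
  have hi : W (u i) (y i) ≠ 0 := fun h0 => h (Finset.prod_eq_zero (Finset.mem_univ i) h0)
  unfold cen
  rw [sub_add_cancel, Real.exp_log (lt_of_le_of_ne ((hW _).1 _) hi.symm)]

/-- the code construction -/
theorem code_of_separated {W : X → Y → ℝ} (hW : ∀ x, IsDist (W x)) {n m : ℕ} {l1 l2 a : ℝ}
    (ha : 0 < a) (hl2 : 0 < l2)
    (ha1 : n * (4 * Fintype.card Y) / a ^ 2 ≤ l1)
    (ha2 : n * (4 * Fintype.card Y) / a ^ 2 ≤ l2 / 2)
    (u : Fin m → Fin n → X)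
    (hent : ∀ j k, |∑ i, negEnt W (u j i) - ∑ i, negEnt W (u k i)| ≤ a)
    (hsep : ∀ j k, j ≠ k → 3 * a + 2 * Real.log (2 / l2) ≤ ∑ i, hel W (u j i) (u k i)) :
    diCode W n m l1 l2 := by
  classical
  have cheb : ∀ j, ∑ y, prodP W (u j) y * ((∑ i, cen W (u j i) (y i)) ^ 2 / a ^ 2) ≤
      n * (4 * Fintype.card Y) / a ^ 2 := by
    intro j
    simp_rw [← mul_div_assoc]
    rw [← Finset.sum_div]
    gcongr
    exact second_moment hW (u j)
  refine ⟨u, fun j => Finset.univ.filter fun y =>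
    Real.exp (∑ i, negEnt W (u j i) - a) ≤ prodP W (u j) y, ?_, ?_⟩
  · intro j
    have hc := Finset.sum_filter_add_sum_filter_not Finset.univ
      (fun y => Real.exp (∑ i, negEnt W (u j i) - a) ≤ prodP W (u j) y) (prodP W (u j))
    rw [prodP_sum hW] at hc
    have hb : ∑ y with ¬ Real.exp (∑ i, negEnt W (u j i) - a) ≤ prodP W (u j) y, prodP W (u j) y
        ≤ ∑ y, prodP W (u j) y * ((∑ i, cen W (u j i) (y i)) ^ 2 / a ^ 2) := by
      refine le_trans (Finset.sum_le_sum fun y hy => ?_)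
        (Finset.sum_le_univ_sum_of_nonneg fun y =>
          mul_nonneg (prodP_nonneg hW _ y) (by positivity))
      rw [Finset.mem_filter] at hy
      by_cases h0 : prodP W (u j) y = 0
      · simp [h0]
      have he := prodP_eq_exp hW _ _ h0
      have hlt := not_le.1 hy.2
      rw [he, Real.exp_lt_exp] at hlt
      have : 1 ≤ (∑ i, cen W (u j i) (y i)) ^ 2 / a ^ 2 := by
        rw [one_le_div (by positivity)]
        nlinarith
      exact le_mul_of_one_le_right (prodP_nonneg hW _ y) this
    unfold probOf
    linarith [cheb j]
  · intro k j hkj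
    have hb : ∀ y ∈ Finset.univ.filter fun y =>
        Real.exp (∑ i, negEnt W (u j i) - a) ≤ prodP W (u j) y, prodP W (u k) y ≤
        prodP W (u k) y * ((∑ i, cen W (u k i) (y i)) ^ 2 / a ^ 2) +
        Real.exp (3 * a / 2) * (√(prodP W (u k) y) * √(prodP W (u j) y)) := by
      intro y hy
      rw [Finset.mem_filter] at hy
      have hP := hy.2
      by_cases h0 : prodP W (u k) y = 0
      · simp [h0]
      have he := prodP_eq_exp hW _ _ h0
      by_cases hG : a ≤ ∑ i, cen W (u k i) (y i)
      · have : 1 ≤ (∑ i, cen W (u k i) (y i)) ^ 2 / a ^ 2 := by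
          rw [one_le_div (by positivity)]
          nlinarith
        have h1 := le_mul_of_one_le_right (prodP_nonneg hW (u k) y) this
        have h2 : 0 ≤ Real.exp (3 * a / 2) * (√(prodP W (u k) y) * √(prodP W (u j) y)) := by
          positivity
        linarith
      · push Not at hG
        have h3 : prodP W (u k) y ≤ Real.exp (3 * a) * prodP W (u j) y := by
          calc prodP W (u k) y ≤ Real.exp (3 * a + (∑ i, negEnt W (u j i) - a)) := by
                rw [he, Real.exp_le_exp]
                have := (abs_le.1 (hent j k)).1
                linarith
            _ = Real.exp (3 * a) * Real.exp (∑ i, negEnt W (u j i) - a) := Real.exp_add _ _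
            _ ≤ _ := by gcongr
        have h4 : √(prodP W (u k) y) ≤ Real.exp (3 * a / 2) * √(prodP W (u j) y) := by
          have := Real.sqrt_le_sqrt h3
          rwa [Real.sqrt_mul (Real.exp_pos _).le, ← Real.exp_half] at this
        have h5 : 0 ≤ prodP W (u k) y * ((∑ i, cen W (u k i) (y i)) ^ 2 / a ^ 2) :=
          mul_nonneg (prodP_nonneg hW _ y) (by positivity)
        have h6 := Real.mul_self_sqrt (prodP_nonneg hW (u k) y)
        nlinarith [Real.sqrt_nonneg (prodP W (u k) y)]
    have hexp : Real.exp (3 * a / 2) * ∑ y, √(prodP W (u k) y) * √(prodP W (u j) y) ≤ l2 / 2 := by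
      calc _ ≤ Real.exp (3 * a / 2) * Real.exp (-(∑ i, hel W (u k i) (u j i)) / 2) := by
            gcongr; exact bhat_le hW _ _
        _ = Real.exp (3 * a / 2 + -(∑ i, hel W (u k i) (u j i)) / 2) := (Real.exp_add _ _).symm
        _ ≤ Real.exp (- Real.log (2 / l2)) := by
            rw [Real.exp_le_exp]; linarith [hsep k j hkj]
        _ = l2 / 2 := by rw [Real.exp_neg, Real.exp_log (by positivity), inv_div]
    unfold probOf
    refine (Finset.sum_le_sum hb).trans ?_
    refine (Finset.sum_le_univ_sum_of_nonneg fun y => add_nonneg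
      (mul_nonneg (prodP_nonneg hW _ y) (by positivity)) (by positivity)).trans ?_
    rw [Finset.sum_add_distrib, ← Finset.mul_sum]
    linarith [cheb k]

end prob

section comb

theorem hamming_ball_card {S : Type*} [Fintype S] [DecidableEq S] (n t : ℕ)
    (hS : 1 ≤ Fintype.card S) (u : Fin n → S) :
    (Finset.univ.filter fun w : Fin n → S => hammingDist u w ≤ t).card
      ≤ 2 ^ n * Fintype.card S ^ t := by
  have hsub : (Finset.univ.filter fun w : Fin n → S => hammingDist u w ≤ t) ⊆
      (Finset.univ.filter fun T : Finset (Fin n) => T.card ≤ t).biUnion fun T =>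
        Fintype.piFinset fun i => if i ∈ T then (Finset.univ : Finset S) else {u i} := by
    intro w hw
    rw [Finset.mem_filter] at hw
    rw [Finset.mem_biUnion]
    refine ⟨Finset.univ.filter fun i => u i ≠ w i, ?_, ?_⟩
    · rw [Finset.mem_filter]
      exact ⟨Finset.mem_univ _, hw.2⟩
    · rw [Fintype.mem_piFinset]
      intro i
      by_cases h : u i = w i
      · simp [h]
      · simp [h]
  refine (Finset.card_le_card hsub).trans (Finset.card_biUnion_le.trans ?_)
  have : ∀ T ∈ (Finset.univ.filter fun T : Finset (Fin n) => T.card ≤ t),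
      (Fintype.piFinset fun i => if i ∈ T then (Finset.univ : Finset S) else {u i}).card
        ≤ Fintype.card S ^ t := by
    intro T hT
    rw [Finset.mem_filter] at hT
    rw [Fintype.card_piFinset]
    have : ∀ i, (if i ∈ T then (Finset.univ : Finset S) else {u i}).card =
        if i ∈ T then Fintype.card S else 1 := by
      intro i; split_ifs <;> simp
    simp_rw [this]
    rw [Finset.prod_ite]
    simp only [Finset.prod_const, one_pow, mul_one]
    apply Nat.pow_le_pow_right hS
    simpa using hT.2
  refine (Finset.sum_le_sum this).trans ?_
  rw [Finset.sum_const, smul_eq_mul]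
  gcongr
  refine (Finset.card_filter_le _ _).trans ?_
  simp

theorem gv_code {S : Type*} [Fintype S] [DecidableEq S] (n t : ℕ) (hS : 1 ≤ Fintype.card S) :
    ∃ C : Finset (Fin n → S), (∀ u ∈ C, ∀ v ∈ C, u ≠ v → t < hammingDist u v) ∧
      Fintype.card S ^ n ≤ C.card * (2 ^ n * Fintype.card S ^ t) := by
  classical
  obtain ⟨C, hC, hmax⟩ := Finset.exists_max_image
    (Finset.univ.filter fun C : Finset (Fin n → S) =>
      ∀ u ∈ C, ∀ v ∈ C, u ≠ v → t < hammingDist u v) Finset.card ⟨∅, by simp⟩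
  rw [Finset.mem_filter] at hC
  refine ⟨C, hC.2, ?_⟩
  have hcov : (Finset.univ : Finset (Fin n → S)) ⊆ C.biUnion fun u =>
      Finset.univ.filter fun w : Fin n → S => hammingDist u w ≤ t := by
    intro w _
    by_contra hw
    simp only [Finset.mem_biUnion, Finset.mem_filter, Finset.mem_univ, true_and, not_exists,
      not_and, not_le] at hw
    have hwC : w ∉ C := fun h => by simpa using hw w h
    have := hmax (insert w C) (by
      rw [Finset.mem_filter]
      refine ⟨Finset.mem_univ _, ?_⟩
      intro u hu v hv huv
      rw [Finset.mem_insert] at hu hv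
      rcases hu with rfl | hu <;> rcases hv with rfl | hv
      · exact absurd rfl huv
      · rw [hammingDist_comm]; exact hw v hv
      · exact hw u hu
      · exact hC.2 u hu v hv huv)
    rw [Finset.card_insert_of_notMem hwC] at this
    omega
  have h := (Finset.card_le_card hcov).trans Finset.card_biUnion_le
  rw [Finset.card_univ, Fintype.card_fun, Fintype.card_fin] at h
  refine h.trans ((Finset.sum_le_sum fun u _ => hamming_ball_card n t hS u).trans ?_)
  simp

variable {X Y : Type*} [Fintype Y]

theorem hel_eq_dist (W : X → Y → ℝ) {x x' : X} {v w : EuclideanSpace ℝ Y}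
    (hv : ∀ y, v y = √(W x y)) (hw : ∀ y, w y = √(W x' y)) : hel W x x' = dist v w ^ 2 := by
  rw [EuclideanSpace.dist_eq, Real.sq_sqrt (Finset.sum_nonneg fun _ _ => sq_nonneg _)]
  unfold hel
  refine Finset.sum_congr rfl fun y _ => ?_
  rw [hv, hw, Real.dist_eq, sq_abs]

theorem code_exists {W : X → Y → ℝ} (hW : ∀ x, IsDist (W x)) {l1 l2 a δ : ℝ} {n t : ℕ}
    (s : Finset (EuclideanSpace ℝ Y)) (hs : ↑s ⊆ sqrtSet W) (hδ : 0 < δ)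
    (hsep : ∀ v ∈ s, ∀ w ∈ s, v ≠ w → δ < dist v w) (hcard : 1 ≤ s.card)
    (ha : 1 ≤ a) (hl2 : 0 < l2)
    (ha1 : n * (4 * Fintype.card Y) / a ^ 2 ≤ l1)
    (ha2 : n * (4 * Fintype.card Y) / a ^ 2 ≤ l2 / 2)
    (ht : 3 * a + 2 * Real.log (2 / l2) ≤ (t + 1) * δ ^ 2) :
    ∃ m, diCode W n m l1 l2 ∧
      s.card ^ n ≤ m * (n * Fintype.card Y + 1) * (2 ^ n * s.card ^ t) := by
  classical
  have hx : ∀ v : s, ∃ x : X, ∀ y, v.1 y = √(W x y) := fun v => hs v.2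
  choose x hx using hx
  have hcs : Fintype.card s = s.card := Fintype.card_coe s
  obtain ⟨C, hC, hCc⟩ := gv_code (S := s) n t (by rw [hcs]; exact hcard)
  rw [hcs] at hCc
  set H : (Fin n → s) → ℝ := fun c => ∑ i, negEnt W (x (c i)) with hH
  have hH0 : ∀ c, H c ≤ 0 := fun c => Finset.sum_nonpos fun i _ => negEnt_le hW _
  have hH1 : ∀ c, -((n * Fintype.card Y : ℕ) : ℝ) ≤ H c := by
    intro c
    have : ∑ _i : Fin n, (-(Fintype.card Y : ℝ)) ≤ H c :=
      Finset.sum_le_sum fun i _ => negEnt_ge hW _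
    simpa using this
  have hmaps : ∀ c ∈ C, ⌊-H c / a⌋₊ ∈ Finset.range (n * Fintype.card Y + 1) := by
    intro c _
    rw [Finset.mem_range, Nat.lt_succ_iff]
    apply Nat.floor_le_of_le
    rw [div_le_iff₀ (by linarith)]
    have := hH1 c
    have h0 : (0 : ℝ) ≤ ((n * Fintype.card Y : ℕ) : ℝ) := by positivity
    nlinarith
  obtain ⟨b, hb, hbmax⟩ := Finset.exists_max_image (Finset.range (n * Fintype.card Y + 1))
    (fun b => (C.filter fun c => ⌊-H c / a⌋₊ = b).card) ⟨0, by simp⟩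
  have hpig := Finset.card_le_mul_card_image_of_maps_to hmaps _ hbmax
  rw [Finset.card_range] at hpig
  set D := C.filter fun c => ⌊-H c / a⌋₊ = b with hD
  refine ⟨D.card, ?_, hCc.trans (Nat.mul_le_mul_right _ hpig)⟩
  have hDm : ∀ j, (D.equivFin.symm j).1 ∈ C ∧ ⌊-H (D.equivFin.symm j).1 / a⌋₊ = b := fun j => by
    have := (D.equivFin.symm j).2
    exact Finset.mem_filter.1 this
  refine code_of_separated hW (a := a) (by linarith) hl2 ha1 ha2
    (fun j i => x ((D.equivFin.symm j).1 i)) ?_ ?_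
  · intro j k
    have e1 := (hDm j).2
    have e2 := (hDm k).2
    change |H (D.equivFin.symm j).1 - H (D.equivFin.symm k).1| ≤ a
    generalize (D.equivFin.symm j).1 = c at *
    generalize (D.equivFin.symm k).1 = c' at *
    have hapos : 0 < a := by linarith
    have p1 := Nat.floor_le (div_nonneg (neg_nonneg.2 (hH0 c)) hapos.le)
    have p2 := Nat.lt_floor_add_one (-H c / a)
    have p3 := Nat.floor_le (div_nonneg (neg_nonneg.2 (hH0 c')) hapos.le)
    have p4 := Nat.lt_floor_add_one (-H c' / a)
    rw [e1] at p1 p2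
    rw [e2] at p3 p4
    rw [le_div_iff₀ hapos] at p1 p3
    rw [div_lt_iff₀ hapos] at p2 p4
    rw [abs_le]
    constructor <;> nlinarith
  · intro j k hjk
    have hne : (D.equivFin.symm j).1 ≠ (D.equivFin.symm k).1 := fun h =>
      hjk (D.equivFin.symm.injective (Subtype.ext h))
    have hd := hC _ (hDm j).1 _ (hDm k).1 hne
    refine ht.trans ?_
    generalize (D.equivFin.symm j).1 = c at *
    generalize (D.equivFin.symm k).1 = c' at *
    change _ ≤ ∑ i, hel W (x (c i)) (x (c' i))
    have hle : ∑ i ∈ Finset.univ.filter (fun i => c i ≠ c' i), δ ^ 2 ≤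
        ∑ i ∈ Finset.univ.filter (fun i => c i ≠ c' i), hel W (x (c i)) (x (c' i)) := by
      refine Finset.sum_le_sum fun i hi => ?_
      rw [Finset.mem_filter] at hi
      rw [hel_eq_dist W (hx (c i)) (hx (c' i))]
      have := hsep _ (c i).2 _ (c' i).2 (fun h => hi.2 (Subtype.ext h))
      gcongr
    refine le_trans ?_ (hle.trans (Finset.sum_le_univ_sum_of_nonneg fun i => hel_nonneg _ _ _))
    rw [Finset.sum_const, nsmul_eq_mul]
    gcongr
    exact_mod_cast hd

/-! ### covering numbers -/

theorem sep_card_le {W : X → Y → ℝ} (hW : ∀ x, IsDist (W x)) {δ : ℝ} (hδ : 0 < δ)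
    (s : Finset (EuclideanSpace ℝ Y)) (hs : ↑s ⊆ sqrtSet W)
    (hsep : ∀ v ∈ s, ∀ w ∈ s, v ≠ w → δ < dist v w) :
    s.card ≤ (⌈Fintype.card Y / δ⌉₊ + 1) ^ Fintype.card Y := by
  classical
  set m := ⌈Fintype.card Y / δ⌉₊ with hm
  have hcoord : ∀ v ∈ s, ∀ y, 0 ≤ v y ∧ v y ≤ 1 := by
    intro v hv y
    obtain ⟨x, hx⟩ := hs hv
    rw [hx]
    exact ⟨Real.sqrt_nonneg _, Real.sqrt_le_one.2 (W_le_one hW x y)⟩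
  have hmaps : ∀ v ∈ s, (fun y => ⌊v y * m⌋₊) ∈
      Fintype.piFinset fun _ : Y => Finset.range (m + 1) := by
    intro v hv
    rw [Fintype.mem_piFinset]
    intro y
    rw [Finset.mem_range, Nat.lt_succ_iff]
    apply Nat.floor_le_of_le
    have := hcoord v hv y
    have h0 : (0 : ℝ) ≤ m := by positivity
    nlinarith
  have hinj : Set.InjOn (fun (v : EuclideanSpace ℝ Y) (y : Y) => ⌊v y * m⌋₊) ↑s := by
    intro v hv w hw hvw
    by_contra hne
    have hlt := hsep v hv w hw hne
    refine absurd hlt (not_lt.2 ?_)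
    rw [EuclideanSpace.dist_eq]
    rw [Real.sqrt_le_left hδ.le]
    have hmle : (Fintype.card Y : ℝ) / δ ≤ m := Nat.le_ceil _
    rw [div_le_iff₀ hδ] at hmle
    rcases isEmpty_or_nonempty Y with hY | hY
    · simp; positivity
    have hc1 : (1 : ℝ) ≤ Fintype.card Y := by exact_mod_cast Fintype.card_pos
    have hmpos : (0 : ℝ) < m := by
      rcases Nat.eq_zero_or_pos m with h | h
      · rw [h] at hmle; simp at hmle
      · exact_mod_cast h
    have hterm : ∀ y, dist (v y) (w y) ^ 2 * (m : ℝ) ^ 2 ≤ 1 := by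
      intro y
      have e : ⌊v y * m⌋₊ = ⌊w y * m⌋₊ := congrFun hvw y
      have p1 := Nat.floor_le (mul_nonneg (hcoord v hv y).1 hmpos.le)
      have p2 := Nat.lt_floor_add_one (v y * m)
      have p3 := Nat.floor_le (mul_nonneg (hcoord w hw y).1 hmpos.le)
      have p4 := Nat.lt_floor_add_one (w y * m)
      rw [e] at p1 p2
      rw [Real.dist_eq, sq_abs, ← mul_pow, sq_le_one_iff_abs_le_one, abs_le]
      constructor <;> nlinarith
    have hsum : (∑ y, dist (v y) (w y) ^ 2) * (m : ℝ) ^ 2 ≤ Fintype.card Y := by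
      rw [Finset.sum_mul]
      refine (Finset.sum_le_sum fun y _ => hterm y).trans ?_
      simp
    have hsq : (Fintype.card Y : ℝ) ^ 2 ≤ (m * δ) ^ 2 := by gcongr
    rw [← mul_le_mul_iff_left₀ (show (0 : ℝ) < m ^ 2 by positivity)]
    nlinarith
  have := Finset.card_le_card_of_injOn _ hmaps hinj
  simpa [Fintype.card_piFinset] using this

theorem exists_sep {W : X → Y → ℝ} (hW : ∀ x, IsDist (W x)) {δ : ℝ} (hδ : 0 < δ) :
    ∃ s : Finset (EuclideanSpace ℝ Y), ↑s ⊆ sqrtSet W ∧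
      (∀ v ∈ s, ∀ w ∈ s, v ≠ w → δ < dist v w) ∧
      sqrtSet W ⊆ ⋃ x ∈ s, Metric.closedBall x δ := by
  classical
  set A : Set ℕ := {k | ∃ s : Finset (EuclideanSpace ℝ Y), ↑s ⊆ sqrtSet W ∧
      (∀ v ∈ s, ∀ w ∈ s, v ≠ w → δ < dist v w) ∧ s.card = k} with hA
  have hbdd : BddAbove A := by
    refine ⟨(⌈Fintype.card Y / δ⌉₊ + 1) ^ Fintype.card Y, ?_⟩
    rintro k ⟨s, hs, hsep, rfl⟩
    exact sep_card_le hW hδ s hs hsep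
  obtain ⟨s, hs, hsep, hk⟩ := Nat.sSup_mem (s := A) ⟨0, ∅, by simp⟩ hbdd
  refine ⟨s, hs, hsep, ?_⟩
  intro w hw
  by_contra hcon
  simp only [Set.mem_iUnion, Metric.mem_closedBall, not_exists, not_le] at hcon
  have hws : w ∉ s := fun h => by
    have := hcon w h
    rw [dist_self] at this
    linarith
  have : s.card + 1 ∈ A := by
    refine ⟨insert w s, ?_, ?_, Finset.card_insert_of_notMem hws⟩
    · intro v hv
      rw [Finset.coe_insert] at hv
      rcases hv with rfl | hv
      · exact hw
      · exact hs hv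
    · intro u hu v hv huv
      rw [Finset.mem_insert] at hu hv
      rcases hu with rfl | hu <;> rcases hv with rfl | hv
      · exact absurd rfl huv
      · exact hcon v hv
      · rw [dist_comm]; exact hcon u hu
      · exact hsep u hu v hv huv
  have := le_csSup hbdd this
  omega

theorem coverNum_le {α : Type*} [PseudoMetricSpace α] {F : Set α} {δ : ℝ} (s : Finset α)
    (hs : ↑s ⊆ F) (hc : F ⊆ ⋃ x ∈ s, Metric.closedBall x δ) :
    (coverNum F δ).toNat ≤ s.card := by
  have h : coverNum F δ ≤ (s.card : ℕ∞) := sInf_le ⟨s, hs, rfl, hc⟩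
  have := ENat.toNat_le_toNat h (ENat.natCast_ne_top _)
  simpa using this

theorem coverNum_attained {W : X → Y → ℝ} (hW : ∀ x, IsDist (W x)) {δ : ℝ} (hδ : 0 < δ) :
    ∃ s : Finset (EuclideanSpace ℝ Y), ↑s ⊆ sqrtSet W ∧
      s.card = (coverNum (sqrtSet W) δ).toNat ∧
      sqrtSet W ⊆ ⋃ x ∈ s, Metric.closedBall x δ := by
  obtain ⟨s, hs, _, hc⟩ := exists_sep hW hδ
  have hne : {n : ℕ∞ | ∃ s : Finset (EuclideanSpace ℝ Y), ↑s ⊆ sqrtSet W ∧ (s.card : ℕ∞) = n ∧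
    sqrtSet W ⊆ ⋃ x ∈ s, Metric.closedBall x δ}.Nonempty := ⟨_, s, hs, rfl, hc⟩
  obtain ⟨s', hs', hcard, hc'⟩ := csInf_mem hne
  refine ⟨s', hs', ?_, hc'⟩
  unfold coverNum
  rw [← hcard]
  simp

theorem coverNum_bound {W : X → Y → ℝ} (hW : ∀ x, IsDist (W x)) {δ : ℝ} (hδ : 0 < δ)
    (hδ1 : δ ≤ 1) :
    Real.log ((coverNum (sqrtSet W) δ).toNat : ℝ) ≤
      Fintype.card Y * (Real.log (Fintype.card Y + 2) - Real.log δ) := by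
  obtain ⟨s, hs, hsep, hc⟩ := exists_sep hW hδ
  have h1 := (coverNum_le s hs hc).trans (sep_card_le hW hδ s hs hsep)
  rw [← Real.log_div (by positivity) hδ.ne', ← Real.log_pow]
  rcases Nat.eq_zero_or_pos (coverNum (sqrtSet W) δ).toNat with h | h
  · rw [h, Nat.cast_zero, Real.log_zero]
    apply Real.log_nonneg
    apply one_le_pow₀
    rw [le_div_iff₀ hδ]
    have : (0 : ℝ) ≤ Fintype.card Y := by positivity
    linarith
  · apply Real.log_le_log (by exact_mod_cast h)
    refine (Nat.cast_le.2 h1).trans ?_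
    push_cast
    gcongr
    have := (Nat.ceil_lt_add_one (show 0 ≤ (Fintype.card Y : ℝ) / δ by positivity)).le
    rw [add_div]
    have h2 : 2 ≤ 2 / δ := by rw [le_div_iff₀ hδ]; linarith
    linarith

/-- converse bound on code size -/
theorem code_le {W : X → Y → ℝ} (hW : ∀ x, IsDist (W x)) {l1 l2 δ : ℝ} (h12 : l1 + l2 < 1)
    {n m : ℕ} (hδ : 0 < δ) (hn : 16 * n * δ ^ 2 < (1 - l1 - l2) ^ 2) (h : diCode W n m l1 l2) :
    m ≤ (coverNum (sqrtSet W) δ).toNat ^ n := by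
  classical
  obtain ⟨s, hs, hcard, hc⟩ := coverNum_attained hW hδ
  obtain ⟨u, E, hE1, hE2⟩ := h
  have hcen : ∀ x : X, ∃ v : s, dist (WithLp.toLp 2 (fun y => √(W x y)) : EuclideanSpace ℝ Y) v.1
      ≤ δ := by
    intro x
    have := hc (show (WithLp.toLp 2 (fun y => √(W x y)) : EuclideanSpace ℝ Y) ∈ sqrtSet W from
      ⟨x, fun y => rfl⟩)
    simp only [Set.mem_iUnion, Metric.mem_closedBall] at this
    obtain ⟨v, hv, hd⟩ := this
    exact ⟨⟨v, hv⟩, hd⟩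
  choose c hcd using hcen
  have hinj : Function.Injective fun (j : Fin m) (i : Fin n) => c (u j i) := by
    intro j k hjk
    by_contra hne
    have ht := tau_le hW (u j) (u k) (E j)
    have e1 := hE1 j
    have e2 := hE2 k j (Ne.symm hne)
    have hsum : ∑ i, hel W (u j i) (u k i) ≤ ∑ _i : Fin n, 4 * δ ^ 2 := by
      refine Finset.sum_le_sum fun i _ => ?_
      rw [hel_eq_dist W (v := WithLp.toLp 2 (fun y => √(W (u j i) y)))
        (w := WithLp.toLp 2 (fun y => √(W (u k i) y))) (fun _ => rfl) (fun _ => rfl)]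
      have d1 := hcd (u j i)
      have d2 := hcd (u k i)
      have e : c (u j i) = c (u k i) := congrFun hjk i
      rw [← e] at d2
      have := dist_triangle_right (WithLp.toLp 2 (fun y => √(W (u j i) y)) : EuclideanSpace ℝ Y)
        (WithLp.toLp 2 (fun y => √(W (u k i) y))) (c (u j i)).1
      calc _ ≤ (2 * δ) ^ 2 := by gcongr; linarith
        _ = _ := by ring
    rw [Finset.sum_const, Finset.card_univ, Fintype.card_fin, nsmul_eq_mul] at hsum
    have : (1 - l1 - l2) ^ 2 ≤ (probOf W (u j) (E j) - probOf W (u k) (E j)) ^ 2 := by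
      apply pow_le_pow_left₀ <;> linarith
    linarith
  have := Fintype.card_le_of_injective _ hinj
  simpa [hcard] using this

end comb

section limits

variable {X Y : Type*} [Fintype Y]

theorem lower_est {W : X → Y → ℝ} (hW : ∀ x, IsDist (W x)) {l1 l2 : ℝ} (h1 : 0 < l1) (h2 : 0 < l2)
    {N : ℕ → ℕ} (hN : ∀ n, IsGreatest {m : ℕ | diCode W n m l1 l2} (N n)) {θ : ℝ} (hθ : 0 < θ)
    (hθ1 : θ < 1) :
    ∃ K : ℝ, 0 < K ∧ ∀ δ : ℝ, 0 < δ → δ ≤ 1 →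
      (⌈K / δ ^ 4⌉₊ : ℝ) * ((1 - θ) * Real.log ((coverNum (sqrtSet W) δ).toNat : ℝ)) ≤
        Real.log (N ⌈K / δ ^ 4⌉₊) + ⌈K / δ ^ 4⌉₊ * (Fintype.card Y + Real.log 2) := by
  obtain ⟨c, hc1, hcl1, hcl2, hclog⟩ : ∃ c : ℝ, 1 ≤ c ∧ 4 * (Fintype.card Y : ℝ) / c ^ 2 ≤ l1 ∧
      4 * (Fintype.card Y : ℝ) / c ^ 2 ≤ l2 / 2 ∧ 2 * Real.log (2 / l2) ≤ c := by
    have ht : Tendsto (fun c : ℝ => 4 * (Fintype.card Y : ℝ) / c ^ 2) atTop (nhds 0) :=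
      Tendsto.const_div_atTop (tendsto_pow_atTop two_ne_zero) _
    have e := (eventually_ge_atTop (1 : ℝ)).and ((ht.eventually_le_const h1).and
      ((ht.eventually_le_const (half_pos h2)).and
        (eventually_ge_atTop (2 * Real.log (2 / l2)))))
    exact e.exists
  have hc0 : 0 < c := by linarith
  refine ⟨(4 * c / θ) ^ 2, by positivity, ?_⟩
  intro δ hδ hδ1
  set n := ⌈(4 * c / θ) ^ 2 / δ ^ 4⌉₊ with hn
  have hnK : (4 * c / θ) ^ 2 / δ ^ 4 ≤ n := Nat.le_ceil _
  have hnpos : 0 < n := Nat.ceil_pos.2 (by positivity)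
  have hnpos' : (0 : ℝ) < n := by exact_mod_cast hnpos
  have hn1 : (1 : ℝ) ≤ n := by exact_mod_cast hnpos
  have hsq1 : 1 ≤ √(n : ℝ) := Real.one_le_sqrt.2 hn1
  have hsqn : √(n : ℝ) * √(n : ℝ) = n := Real.mul_self_sqrt hnpos'.le
  have hsqK : 4 * c / θ / δ ^ 2 ≤ √(n : ℝ) := by
    apply Real.le_sqrt_of_sq_le
    rw [div_pow, ← pow_mul]
    exact hnK
  rw [div_div, div_le_iff₀ (by positivity)] at hsqK
  have hlogN : 0 ≤ Real.log (N n) := Real.log_natCast_nonneg _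
  obtain ⟨s, hs, hsep, hcov⟩ := exists_sep hW hδ
  have hle := coverNum_le s hs hcov
  have hlog2 : 0 < Real.log 2 := Real.log_pos (by norm_num)
  rcases Nat.eq_zero_or_pos (coverNum (sqrtSet W) δ).toNat with h0 | h0
  · rw [h0, Nat.cast_zero, Real.log_zero]
    have : 0 ≤ (n : ℝ) * (Fintype.card Y + Real.log 2) := by positivity
    linarith
  have hM : 1 ≤ s.card := by omega
  have hvar : n * (4 * (Fintype.card Y : ℝ)) / (c * √(n : ℝ)) ^ 2
      = 4 * (Fintype.card Y : ℝ) / c ^ 2 := by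
    rw [mul_pow, Real.sq_sqrt hnpos'.le]
    field_simp
  obtain ⟨m, hm, hcard⟩ := code_exists hW (l1 := l1) (l2 := l2) (a := c * √(n : ℝ)) (n := n)
    (t := ⌊θ * n⌋₊) s hs hδ hsep hM (by nlinarith) h2 (by rw [hvar]; exact hcl1)
    (by rw [hvar]; exact hcl2) (by
      have hf := (Nat.lt_floor_add_one (θ * n)).le
      have : 3 * (c * √(n : ℝ)) + 2 * Real.log (2 / l2) ≤ 4 * c * √(n : ℝ) := by nlinarith
      refine this.trans ?_
      calc 4 * c * √(n : ℝ) ≤ (√(n : ℝ) * (θ * δ ^ 2)) * √(n : ℝ) := by gcongr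
        _ = θ * n * δ ^ 2 := by linear_combination (θ * δ ^ 2) * hsqn
        _ ≤ _ := by gcongr)
  have hmN : m ≤ N n := (hN n).2 hm
  have hmpos : 0 < m := by
    rcases Nat.eq_zero_or_pos m with h | h
    · rw [h] at hcard
      have : 0 < s.card ^ n := by positivity
      omega
    · exact h
  have hMr : (1 : ℝ) ≤ s.card := by exact_mod_cast hM
  have hmr : (0 : ℝ) < m := by exact_mod_cast hmpos
  have hcr : ((s.card : ℝ)) ^ n ≤ m * (n * Fintype.card Y + 1) * (2 ^ n * (s.card : ℝ) ^ ⌊θ * n⌋₊) := by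
    exact_mod_cast hcard
  have hl := Real.log_le_log (by positivity) hcr
  have hMpos : (0 : ℝ) < s.card := by linarith
  rw [Real.log_mul (by positivity) (by positivity), Real.log_mul (by positivity) (by positivity),
    Real.log_mul (by positivity) (by positivity), Real.log_pow, Real.log_pow, Real.log_pow] at hl
  have b1 : Real.log m ≤ Real.log (N n) := Real.log_le_log hmr (by exact_mod_cast hmN)
  have b2 : Real.log ((n : ℝ) * Fintype.card Y + 1) ≤ n * Fintype.card Y := by
    have := Real.log_le_sub_one_of_pos (show 0 < (n : ℝ) * Fintype.card Y + 1 by positivity)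
    linarith
  have hlM : 0 ≤ Real.log s.card := Real.log_nonneg hMr
  have b3 : (⌊θ * n⌋₊ : ℝ) * Real.log s.card ≤ θ * n * Real.log s.card := by
    gcongr
    exact Nat.floor_le (by positivity)
  have b4 : Real.log ((coverNum (sqrtSet W) δ).toNat : ℝ) ≤ Real.log s.card :=
    Real.log_le_log (by exact_mod_cast h0) (by exact_mod_cast hle)
  have b5 : (n : ℝ) * ((1 - θ) * Real.log ((coverNum (sqrtSet W) δ).toNat : ℝ)) ≤
      n * ((1 - θ) * Real.log s.card) := by
    have : 0 ≤ 1 - θ := by linarith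
    gcongr
  linarith

theorem ratio_eq (a : ℝ) (n : ℕ) :
    Real.logb 2 a / ((n : ℝ) * Real.logb 2 n) = Real.log a / (n * Real.log n) := by
  have : Real.log 2 ≠ 0 := (Real.log_pos (by norm_num)).ne'
  unfold Real.logb
  rw [← mul_div_assoc, div_div_div_cancel_right₀ this]

theorem mink_bounded {W : X → Y → ℝ} (hW : ∀ x, IsDist (W x)) :
    IsBoundedUnder (· ≤ ·) (nhdsWithin 0 (Set.Ioi 0))
      (fun δ : ℝ => Real.log ((coverNum (sqrtSet W) δ).toNat : ℝ) / (-Real.log δ)) := by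
  refine ⟨Fintype.card Y * (Real.log (Fintype.card Y + 2) + 1), ?_⟩
  rw [eventually_map]
  have h1 : ∀ᶠ δ : ℝ in nhdsWithin 0 (Set.Ioi 0), Real.log δ ≤ -1 :=
    Real.tendsto_log_nhdsGT_zero.eventually_le_atBot (-1)
  have h2 : ∀ᶠ δ : ℝ in nhdsWithin 0 (Set.Ioi 0), δ ≤ 1 :=
    eventually_nhdsWithin_of_eventually_nhds (eventually_le_nhds (by norm_num))
  filter_upwards [h1, h2, self_mem_nhdsWithin] with δ hl hle hpos
  rw [div_le_iff₀ (by linarith)]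
  refine (coverNum_bound hW hpos hle).trans ?_
  have hL : 0 ≤ Real.log ((Fintype.card Y : ℝ) + 2) :=
    Real.log_nonneg (by have : (0 : ℝ) ≤ Fintype.card Y := by positivity
                        linarith)
  rw [mul_assoc]
  gcongr
  nlinarith

theorem mink_nonneg {W : X → Y → ℝ} :
    ∀ᶠ δ : ℝ in nhdsWithin 0 (Set.Ioi 0),
      0 ≤ Real.log ((coverNum (sqrtSet W) δ).toNat : ℝ) / (-Real.log δ) := by
  have h2 : ∀ᶠ δ : ℝ in nhdsWithin 0 (Set.Ioi 0), δ ≤ 1 :=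
    eventually_nhdsWithin_of_eventually_nhds (eventually_le_nhds (by norm_num))
  filter_upwards [h2, self_mem_nhdsWithin] with δ hle hpos
  have := Real.log_nonpos (le_of_lt hpos) hle
  exact div_nonneg (Real.log_natCast_nonneg _) (by linarith)

theorem tendsto_logn : Tendsto (fun n : ℕ => Real.log n) atTop atTop :=
  Real.tendsto_log_atTop.comp tendsto_natCast_atTop_atTop

theorem upper_event {W : X → Y → ℝ} (hW : ∀ x, IsDist (W x)) {l1 l2 : ℝ} (h12 : l1 + l2 < 1)
    {N : ℕ → ℕ} (hN : ∀ n, IsGreatest {m : ℕ | diCode W n m l1 l2} (N n)) {b : ℝ}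
    (hb : upperMinkDim (sqrtSet W) < 2 * b) :
    ∀ᶠ n : ℕ in atTop, Real.log (N n) / (n * Real.log n) ≤ b := by
  obtain ⟨a, hda, hab⟩ := exists_between hb
  set τ := 1 - l1 - l2 with hτ
  have hτ0 : 0 < τ := by linarith
  have hev := eventually_lt_of_limsup_lt hda (mink_bounded hW)
  have hδ : Tendsto (fun n : ℕ => τ / 8 / √(n : ℝ)) atTop (nhdsWithin 0 (Set.Ioi 0)) := by
    rw [tendsto_nhdsWithin_iff]
    constructor
    · exact Tendsto.const_div_atTop
        (Real.tendsto_sqrt_atTop.comp tendsto_natCast_atTop_atTop) _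
    · filter_upwards [eventually_gt_atTop 0] with n hn
      have : (0 : ℝ) < n := by exact_mod_cast hn
      simp only [Set.mem_Ioi]
      positivity
  have hlt1 : ∀ᶠ δ : ℝ in nhdsWithin 0 (Set.Ioi 0), δ < 1 :=
    eventually_nhdsWithin_of_eventually_nhds (eventually_lt_nhds (by norm_num))
  filter_upwards [hδ.eventually hev, hδ.eventually hlt1, eventually_gt_atTop 1,
    tendsto_logn.eventually_ge_atTop (a * (-Real.log (τ / 8)) / (b - a / 2))] with n h1 h2 h3 h4
  have hn : (0 : ℝ) < n := by exact_mod_cast (by omega : 0 < n)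
  have hlogn : 0 < Real.log n := Real.log_pos (by exact_mod_cast h3)
  have hδ0 : 0 < τ / 8 / √(n : ℝ) := by positivity
  have hle := code_le hW h12 hδ0 (by
    rw [div_pow, Real.sq_sqrt hn.le, div_pow]
    field_simp
    rw [← hτ]
    nlinarith [pow_pos hτ0 2]) (hN n).1
  rw [div_le_iff₀ (by positivity)]
  have hl0 : Real.log (τ / 8 / √(n : ℝ)) < 0 := Real.log_neg hδ0 h2
  rw [div_lt_iff₀ (by linarith)] at h1
  rw [Real.log_div (by positivity) (by positivity), Real.log_sqrt hn.le] at h1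
  have hG : Real.log (N n) ≤ n * Real.log ((coverNum (sqrtSet W) (τ / 8 / √(n : ℝ))).toNat : ℝ) := by
    rcases Nat.eq_zero_or_pos (N n) with h | h
    · rw [h, Nat.cast_zero, Real.log_zero]
      exact mul_nonneg hn.le (Real.log_natCast_nonneg _)
    · rw [← Real.log_pow]
      exact Real.log_le_log (by exact_mod_cast h) (by exact_mod_cast hle)
  rw [div_le_iff₀ (by linarith)] at h4
  refine hG.trans ?_
  rw [mul_left_comm]
  gcongr
  nlinarith

theorem lower_freq {W : X → Y → ℝ} (hW : ∀ x, IsDist (W x)) {l1 l2 : ℝ} (h1 : 0 < l1) (h2 : 0 < l2)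
    {N : ℕ → ℕ} (hN : ∀ n, IsGreatest {m : ℕ | diCode W n m l1 l2} (N n)) {b : ℝ} (hb0 : 0 < b)
    (hb : 4 * b < upperMinkDim (sqrtSet W)) :
    ∃ᶠ n : ℕ in atTop, b ≤ Real.log (N n) / (n * Real.log n) := by
  obtain ⟨a, hba, had⟩ := exists_between hb
  have ha0 : 0 < a := by linarith
  have hq : 4 * b / a < 1 := by rw [div_lt_one ha0]; exact hba
  have hq0 : 0 < 4 * b / a := by positivity
  obtain ⟨K, hK, hest⟩ := lower_est hW h1 h2 hN (θ := (1 - 4 * b / a) / 2) (by linarith)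
    (by linarith)
  have hθa : (1 - (1 - 4 * b / a) / 2) * a = (a + 4 * b) / 2 := by field_simp; ring
  have hfr := frequently_lt_of_lt_limsup (IsBoundedUnder.isCoboundedUnder_le
    (isBoundedUnder_of_eventually_ge (mink_nonneg (W := W)))) had
  have hlt1 : ∀ᶠ δ : ℝ in nhdsWithin 0 (Set.Ioi 0), δ < 1 :=
    eventually_nhdsWithin_of_eventually_nhds (eventually_lt_nhds (by norm_num))
  have hnt : Tendsto (fun δ : ℝ => ⌈K / δ ^ 4⌉₊) (nhdsWithin 0 (Set.Ioi 0)) atTop := by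
    apply tendsto_nat_ceil_atTop.comp
    have h4 : Tendsto (fun δ : ℝ => (δ⁻¹) ^ 4) (nhdsWithin 0 (Set.Ioi 0)) atTop :=
      (tendsto_pow_atTop (by norm_num)).comp tendsto_inv_nhdsGT_zero
    have := h4.const_mul_atTop hK
    refine this.congr fun δ => ?_
    rw [inv_pow, div_eq_mul_inv]
  refine hnt.frequently (p := fun n : ℕ => b ≤ Real.log (N n) / (n * Real.log n)) ?_
  have hbig := (hnt.eventually (eventually_gt_atTop 1)).and
    ((hnt.eventually (tendsto_logn.eventually_ge_atTop
    (((a + 4 * b) / 2 * Real.log (K + 1) / 4 + (Fintype.card Y + Real.log 2)) /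
      ((a + 4 * b) / 8 - b)))))
  refine (hfr.and_eventually (hbig.and (hlt1.and self_mem_nhdsWithin))).mono ?_
  rintro δ ⟨hG, ⟨hn1, hL⟩, hδ1, hδ0⟩
  have hδ0 : 0 < δ := hδ0
  have hE := hest δ hδ0 hδ1.le
  have hceil : (⌈K / δ ^ 4⌉₊ : ℝ) ≤ (K + 1) / δ ^ 4 := by
    have := (Nat.ceil_lt_add_one (show 0 ≤ K / δ ^ 4 by positivity)).le
    have h1 : 1 ≤ 1 / δ ^ 4 := by
      rw [le_div_iff₀ (by positivity), one_mul]
      exact pow_le_one₀ hδ0.le hδ1.le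
    rw [add_div]
    linarith
  generalize ⌈K / δ ^ 4⌉₊ = n at *
  have hn : (0 : ℝ) < n := by exact_mod_cast (by omega : 0 < n)
  have hlogn : 0 < Real.log n := Real.log_pos (by exact_mod_cast hn1)
  have hlc := Real.log_le_log hn hceil
  rw [Real.log_div (by positivity) (by positivity), Real.log_pow] at hlc
  push_cast at hlc
  have hld : Real.log δ < 0 := Real.log_neg hδ0 hδ1
  rw [lt_div_iff₀ (by linarith)] at hG
  rw [div_le_iff₀ (by linarith)] at hL
  rw [le_div_iff₀ (by positivity)]
  set G := Real.log ((coverNum (sqrtSet W) δ).toNat : ℝ)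
  have hG2 : (a + 4 * b) / 2 * (-Real.log δ) ≤ (1 - (1 - 4 * b / a) / 2) * G := by
    rw [← hθa, mul_assoc]
    apply mul_le_mul_of_nonneg_left hG.le
    linarith
  have hkey : b * Real.log n ≤ (1 - (1 - 4 * b / a) / 2) * G - (Fintype.card Y + Real.log 2) := by
    have : (a + 4 * b) / 2 * ((Real.log n - Real.log (K + 1)) / 4) ≤
        (a + 4 * b) / 2 * (-Real.log δ) := by
      apply mul_le_mul_of_nonneg_left _ (by linarith)
      linarith
    nlinarith
  have := mul_le_mul_of_nonneg_left hkey hn.le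
  nlinarith

end limits

/-- Theorem (optimistic superexponential DI capacity bounds): for a channel `W` with finite
output and any `λ₁,λ₂ > 0`, `λ₁+λ₂ < 1`, with `N n` the maximal DI code size,
`(1/4)·d̄_M(√X̃) ≤ limsup log₂ N(n)/(n log₂ n) ≤ (1/2)·d̄_M(√X̃)`. -/
theorem stmt13 {X Y : Type*} [Fintype Y] (W : X → Y → ℝ) (hW : ∀ x, IsDist (W x))
    (l1 l2 : ℝ) (h1 : 0 < l1) (h2 : 0 < l2) (h12 : l1 + l2 < 1)
    (N : ℕ → ℕ) (hN : ∀ n, IsGreatest {m : ℕ | diCode W n m l1 l2} (N n)) :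
    (1 / 4 : ℝ) * upperMinkDim (sqrtSet W) ≤
        Filter.limsup (fun n : ℕ =>
          Real.logb 2 (N n) / ((n : ℝ) * Real.logb 2 n)) Filter.atTop ∧
      Filter.limsup (fun n : ℕ =>
          Real.logb 2 (N n) / ((n : ℝ) * Real.logb 2 n)) Filter.atTop ≤
        (1 / 2 : ℝ) * upperMinkDim (sqrtSet W) := by
  simp_rw [ratio_eq]
  have hnn : ∀ n : ℕ, 0 ≤ Real.log (N n) / (n * Real.log n) := fun n =>
    div_nonneg (Real.log_natCast_nonneg _)
      (mul_nonneg (Nat.cast_nonneg _) (Real.log_natCast_nonneg _))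
  have hcob : IsCoboundedUnder (· ≤ ·) atTop
      (fun n : ℕ => Real.log (N n) / (n * Real.log n)) :=
    IsBoundedUnder.isCoboundedUnder_le (isBoundedUnder_of ⟨0, hnn⟩)
  have hbdd : IsBoundedUnder (· ≤ ·) atTop
      (fun n : ℕ => Real.log (N n) / (n * Real.log n)) :=
    isBoundedUnder_of_eventually_le
      (upper_event hW h12 hN (b := upperMinkDim (sqrtSet W) / 2 + 1) (by linarith))
  constructor
  · refine le_of_forall_lt fun b hb => ?_
    obtain ⟨b', hbb, hb'⟩ := exists_between hb
    refine lt_of_lt_of_le hbb ?_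
    apply le_limsup_of_frequently_le _ hbdd
    rcases le_or_gt b' 0 with h | h
    · exact Frequently.of_forall fun n => h.trans (hnn n)
    · exact lower_freq hW h1 h2 hN h (by linarith)
  · refine le_of_forall_gt fun b hb => ?_
    obtain ⟨b', hbb, hb'⟩ := exists_between hb
    refine lt_of_le_of_lt ?_ hb'
    exact limsup_le_of_le hcob (upper_event hW h12 hN (by linarith))
end

section
/- Let 0 < θ < 1 and let A = A^{(θ)} be the arc channel on the circle ℝ/ℤ. Then for every λ₁, λ₂ > 0 with λ₁ + λ₂ < 1, the limit lim_{n→∞} (1/(n log₂ n)) · log₂ N_DI(n,λ₁,λ₂) exists and equals 1. -/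
open Real Filter MeasureTheory

namespace Arc

/-- The output measure `A_{u}` (unnormalized) of the arc channel on block length `n`: the
pushforward of the product of `n` copies of Lebesgue measure restricted to `[0,θ]` under
`t ↦ (u i + t i mod ℤ)_i`.  Dividing by `θ^n` gives the product of the uniform distributions
on the arcs `[u i, u i + θ] mod ℤ`. -/
noncomputable def arcOut (θ : ℝ) {n : ℕ} (u : Fin n → AddCircle (1 : ℝ)) :
    Measure (Fin n → AddCircle (1 : ℝ)) :=
  Measure.map (fun t : Fin n → ℝ => fun i => u i + (t i : AddCircle (1 : ℝ)))
    (Measure.pi fun _ : Fin n => volume.restrict (Set.Icc (0 : ℝ) θ))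

/-- The probability `A_{u}(E)` of a set of output words under the arc channel. -/
noncomputable def arcProb (θ : ℝ) {n : ℕ} (u : Fin n → AddCircle (1 : ℝ))
    (E : Set (Fin n → AddCircle (1 : ℝ))) : ℝ :=
  (arcOut θ u E).toReal / θ ^ n

/-- An `(n,N,λ₁,λ₂)`-deterministic identification code for the arc channel `A^{(θ)}`. -/
def arcCode (θ : ℝ) (n N : ℕ) (l1 l2 : ℝ) : Prop :=
  ∃ (u : Fin N → Fin n → AddCircle (1 : ℝ))
    (E : Fin N → Set (Fin n → AddCircle (1 : ℝ))),
    (∀ j, MeasurableSet (E j)) ∧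
    (∀ j, 1 - l1 ≤ arcProb θ (u j) (E j)) ∧
    (∀ j k, j ≠ k → arcProb θ (u j) (E k) ≤ l2)

end Arc

open Arc

lemma arc_meas {n : ℕ} (u : Fin n → AddCircle (1 : ℝ)) :
    Measurable (fun t : Fin n → ℝ => fun i => u i + (t i : AddCircle (1 : ℝ))) := by
  refine measurable_pi_lambda _ fun i => ?_
  exact (AddCircle.measurable_mk'.comp (measurable_pi_apply i)).const_add (u i)

lemma arcOut_eq (θ : ℝ) {n : ℕ} (u : Fin n → AddCircle (1 : ℝ))
    {E : Set (Fin n → AddCircle (1 : ℝ))} (hE : MeasurableSet E) :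
    arcOut θ u E = volume (((fun t : Fin n → ℝ => fun i => u i + (t i : AddCircle (1 : ℝ))) ⁻¹' E)
      ∩ Set.univ.pi fun _ => Set.Icc (0 : ℝ) θ) := by
  unfold arcOut
  rw [Measure.map_apply (arc_meas u) hE, ← Measure.restrict_pi_pi,
    Measure.restrict_apply (arc_meas u hE), volume_pi]

lemma volB (θ : ℝ) (hθ : 0 < θ) (n : ℕ) :
    volume (Set.univ.pi fun _ : Fin n => Set.Icc (0 : ℝ) θ) = ENNReal.ofReal (θ ^ n) := by
  rw [volume_pi_pi]; simp [ENNReal.ofReal_pow hθ.le]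

lemma upper_cmp (θ : ℝ) (hθ : 0 < θ) {n : ℕ} (u v : Fin n → AddCircle (1 : ℝ)) (s : Fin n → ℝ)
    (hv : ∀ i, v i = u i + (s i : AddCircle (1 : ℝ))) (γ : ℝ) (hγ0 : 0 < γ) (hγ : γ < 1)
    (hs : ∀ i, |s i| ≤ θ * γ / n)
    {E : Set (Fin n → AddCircle (1 : ℝ))} (hE : MeasurableSet E) :
    arcProb θ u E ≤ arcProb θ v E + γ := by
  rcases Nat.eq_zero_or_pos n with hn | hn
  · subst hn
    have : u = v := Subsingleton.elim _ _
    rw [this]; linarith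
  have hn' : (1 : ℝ) ≤ n := by exact_mod_cast hn
  set η := θ * γ / n with hη
  have hηle : η ≤ θ := by
    rw [hη, div_le_iff₀ (by linarith)]
    nlinarith
  set B : Set (Fin n → ℝ) := Set.univ.pi fun _ => Set.Icc (0 : ℝ) θ with hB
  set C : Set (Fin n → ℝ) := Set.univ.pi fun i => Set.Icc (max 0 (s i)) (min θ (θ + s i)) with hC
  set F := (fun (u : Fin n → AddCircle (1 : ℝ)) => (fun t : Fin n → ℝ => fun i => u i + (t i : AddCircle (1 : ℝ))) ⁻¹' E) with hF
  have eu : arcOut θ u E = volume (F u ∩ B) := arcOut_eq θ u hE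
  have ev : arcOut θ v E = volume (F v ∩ B) := arcOut_eq θ v hE
  have vB : volume B = ENNReal.ofReal (θ ^ n) := volB θ hθ n
  have finB : volume B ≠ ⊤ := by rw [vB]; exact ENNReal.ofReal_ne_top
  have hCB : C ⊆ B := by
    intro t ht i hi
    have := ht i hi
    simp only [Set.mem_Icc, max_le_iff, le_min_iff] at this ⊢
    exact ⟨this.1.1, this.2.1⟩
  have mC : MeasurableSet C := MeasurableSet.univ_pi fun i => measurableSet_Icc
  have vC : ENNReal.ofReal ((θ - η) ^ n) ≤ volume C := by
    rw [hC, volume_pi_pi, ENNReal.ofReal_pow (by linarith)]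
    have : ENNReal.ofReal (θ - η) ^ n = ∏ i : Fin n, ENNReal.ofReal (θ - η) := by simp
    rw [this]
    refine Finset.prod_le_prod' fun i _ => ?_
    rw [Real.volume_Icc]
    apply ENNReal.ofReal_le_ofReal
    have := hs i
    rcases abs_cases (s i) with h | h
    · rw [max_eq_right h.2, min_eq_left (by linarith)]; linarith
    · rw [max_eq_left h.2.le, min_eq_right (by linarith)]; linarith
  have sub : F u ∩ B ⊆ (B \ C) ∪ (fun t => t - s) ⁻¹' (F v ∩ B) := by
    intro t ⟨h1, h2⟩
    by_cases hc : t ∈ C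
    · right
      refine ⟨?_, ?_⟩
      · simp only [hF, Set.mem_preimage] at h1 ⊢
        convert h1 using 2 with i
        rw [hv i, Pi.sub_apply, AddCircle.coe_sub]; abel
      · intro i hi
        have := hc i hi
        simp only [Set.mem_Icc, max_le_iff, le_min_iff, Pi.sub_apply] at this ⊢
        constructor <;> linarith [this.1.2, this.2.2]
    · left; exact ⟨h2, hc⟩
  have key : volume.real (F u ∩ B) ≤ volume.real (F v ∩ B) + (θ ^ n - (θ - η) ^ n) := by
    have a1 : volume (F u ∩ B) ≤ volume (B \ C) + volume (F v ∩ B) := by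
      refine (measure_mono sub).trans ((measure_union_le _ _).trans ?_)
      have : volume ((fun t => t - s) ⁻¹' (F v ∩ B)) = volume (F v ∩ B) := by
        simp only [sub_eq_add_neg]
        exact measure_preimage_add_right _ _ _
      rw [this]
    have f1 : volume (B \ C) ≠ ⊤ := measure_ne_top_of_subset Set.sdiff_subset finB
    have f2 : volume (F v ∩ B) ≠ ⊤ := measure_ne_top_of_subset Set.inter_subset_right finB
    have a2 := ENNReal.toReal_mono (ENNReal.add_ne_top.2 ⟨f1, f2⟩) a1
    rw [ENNReal.toReal_add f1 f2] at a2
    have a3 : volume.real (B \ C) = volume.real B - volume.real C :=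
      measureReal_sdiff hCB mC finB
    have a4 : volume.real B = θ ^ n := by
      rw [Measure.real, vB, ENNReal.toReal_ofReal (by positivity)]
    have a5 : (θ - η) ^ n ≤ volume.real C := by
      have := ENNReal.toReal_mono (measure_ne_top_of_subset hCB finB) vC
      rwa [ENNReal.toReal_ofReal (pow_nonneg (by linarith) _)] at this
    simp only [Measure.real] at *
    linarith
  have bern : θ ^ n * (1 - γ) ≤ (θ - η) ^ n := by
    have e : θ - η = θ * (1 + -(γ / n)) := by rw [hη]; ring
    rw [e, mul_pow]
    apply mul_le_mul_of_nonneg_left _ (by positivity)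
    have h1 : γ / n ≤ 1 := by rw [div_le_iff₀ (by linarith)]; linarith
    have := one_add_mul_le_pow (a := -(γ / n)) (by linarith) n
    have e2 : (n : ℝ) * -(γ / n) = -γ := by field_simp
    rw [e2] at this
    linarith
  unfold arcProb
  rw [eu, ev]
  have hp : 0 < θ ^ n := by positivity
  rw [div_add' _ _ _ hp.ne']
  gcongr
  simp only [Measure.real] at key
  nlinarith

lemma upper_card (θ : ℝ) (hθ : 0 < θ) {n M : ℕ} (l1 l2 γ : ℝ) (hγ0 : 0 < γ) (hγ : γ < 1)
    (hγl : l2 + γ < 1 - l1) (hcode : arcCode θ n M l1 l2) (K : ℕ) (hK0 : 0 < K)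
    (hK : n / (θ * γ) ≤ K) : M ≤ K ^ n := by
  obtain ⟨u, E, hE, hu, huv⟩ := hcode
  have rep : ∀ x : AddCircle (1 : ℝ), ∃ r : ℝ, 0 ≤ r ∧ r < 1 ∧ (r : AddCircle (1 : ℝ)) = x := by
    intro x
    have h := (AddCircle.equivIco 1 0 x).2
    refine ⟨(AddCircle.equivIco 1 0 x : ℝ), h.1, by simpa using h.2, ?_⟩
    exact (AddCircle.equivIco 1 0).symm_apply_apply x
  choose r r0 r1 hr using rep
  have hKr : (0 : ℝ) < K := by exact_mod_cast hK0
  let c : Fin M → Fin n → Fin K := fun j i => ⟨⌊K * r (u j i)⌋₊, by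
    rw [Nat.floor_lt (mul_nonneg hKr.le (r0 _))]
    nlinarith [r1 (u j i)]⟩
  have inj : Function.Injective c := by
    intro j k hjk
    by_contra hne
    have := upper_cmp θ hθ (u k) (u j) (fun i => r (u j i) - r (u k i)) (fun i => by
      rw [AddCircle.coe_sub, hr, hr]; abel) γ hγ0 hγ (fun i => by
      have e : ⌊K * r (u j i)⌋₊ = ⌊K * r (u k i)⌋₊ := by
        have := congrFun hjk i
        simpa [c] using this
      have p1 := Nat.floor_le (mul_nonneg hKr.le (r0 (u j i)))
      have p2 := Nat.floor_le (mul_nonneg hKr.le (r0 (u k i)))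
      have p3 := Nat.lt_floor_add_one (K * r (u j i))
      have p4 := Nat.lt_floor_add_one (K * r (u k i))
      rw [e] at p1 p3
      have q : (K : ℝ) * |r (u j i) - r (u k i)| ≤ 1 := by
        have ea : (K : ℝ) * |r (u j i) - r (u k i)| = |K * (r (u j i) - r (u k i))| := by
          rw [abs_mul, abs_of_pos hKr]
        rw [ea, abs_le]
        constructor <;> nlinarith
      have hnpos : (0 : ℝ) < n := by
        have := i.pos
        exact_mod_cast this
      rw [div_le_iff₀ (by positivity)] at hK
      rw [le_div_iff₀ hnpos]
      calc |r (u j i) - r (u k i)| * n ≤ |r (u j i) - r (u k i)| * (K * (θ * γ)) := by gcongr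
        _ = (K * |r (u j i) - r (u k i)|) * (θ * γ) := by ring
        _ ≤ 1 * (θ * γ) := by gcongr
        _ = θ * γ := one_mul _) (hE k)
    have a := hu k
    have b := huv j k hne
    linarith
  have := Fintype.card_le_of_injective c inj
  simpa using this

lemma gv (n K m : ℕ) (hK : 0 < K) : ∃ S : Finset (Fin n → Fin K),
    (∀ x ∈ S, ∀ y ∈ S, x ≠ y → m < hammingDist x y) ∧ K ^ n ≤ S.card * (2 ^ n * K ^ m) := by
  classical
  obtain ⟨S, hS, hmax⟩ := Finset.exists_max_image
    (Finset.univ.filter fun S : Finset (Fin n → Fin K) =>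
      ∀ x ∈ S, ∀ y ∈ S, x ≠ y → m < hammingDist x y) Finset.card ⟨∅, by simp⟩
  simp only [Finset.mem_filter, Finset.mem_univ, true_and] at hS hmax
  refine ⟨S, hS, ?_⟩
  let G : (Fin n → Fin K) → Finset (Fin n) → Finset (Fin n → Fin K) := fun x T =>
    Fintype.piFinset fun i => if i ∈ T then Finset.univ else {x i}
  have hG : ∀ x T, T.card ≤ m → (G x T).card ≤ K ^ m := by
    intro x T hT
    simp only [G, Fintype.card_piFinset, apply_ite Finset.card, Finset.card_univ, Fintype.card_fin,
      Finset.card_singleton, Finset.prod_ite_mem, Finset.univ_inter, Finset.prod_const]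
    exact Nat.pow_le_pow_right hK hT
  have cov : (Finset.univ : Finset (Fin n → Fin K)) ⊆ S.biUnion fun x =>
      ((Finset.univ : Finset (Finset (Fin n))).filter fun T => T.card ≤ m).biUnion (G x) := by
    intro y _
    have : ∃ x ∈ S, hammingDist x y ≤ m := by
      by_contra! hcon
      have hy : y ∉ S := fun h => by simpa using hcon y h
      have := hmax (insert y S) (by
        intro a ha b hb hab
        rw [Finset.mem_insert] at ha hb
        rcases ha with rfl | ha <;> rcases hb with rfl | hb
        · exact absurd rfl hab
        · rw [hammingDist_comm]; exact hcon b hb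
        · exact hcon a ha
        · exact hS a ha b hb hab)
      rw [Finset.card_insert_of_notMem hy] at this
      omega
    obtain ⟨x, hx, hd⟩ := this
    simp only [Finset.mem_biUnion, Finset.mem_filter, Finset.mem_univ, true_and]
    refine ⟨x, hx, Finset.univ.filter fun i => x i ≠ y i, hd, ?_⟩
    simp only [G, Fintype.mem_piFinset]
    intro i
    by_cases h : x i = y i <;> simp [h]
  have := Finset.card_le_card cov
  rw [Finset.card_univ, Fintype.card_fun, Fintype.card_fin, Fintype.card_fin] at this
  refine this.trans (Finset.card_biUnion_le_card_mul _ _ _ fun x _ => ?_)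
  refine (Finset.card_biUnion_le_card_mul _ _ (K ^ m) fun T hT => hG x T (by simpa using hT)).trans ?_
  gcongr
  refine (Finset.card_filter_le _ _).trans ?_
  simp

lemma lower_code (θ : ℝ) (hθ0 : 0 < θ) (hθ1 : θ < 1) (l1 l2 : ℝ) (h1 : 0 < l1) (h2 : 0 < l2)
    (n K m : ℕ) (hK : 0 < K) (S : Finset (Fin n → Fin K))
    (hS : ∀ x ∈ S, ∀ y ∈ S, x ≠ y → m < hammingDist x y)
    (hm : θ * Real.log (1 / l2) * K ≤ (m + 1) * (1 - θ)) : arcCode θ n S.card l1 l2 := by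
  classical
  have hKr : (0 : ℝ) < K := by exact_mod_cast hK
  let X : (Fin n → Fin K) → Fin n → ℝ := fun c i => (1 - θ) * ((c i : ℕ) : ℝ) / K
  have X0 : ∀ c i, 0 ≤ X c i := fun c i => by
    have : 0 ≤ 1 - θ := by linarith
    positivity
  have X1 : ∀ c i, X c i + θ < 1 := fun c i => by
    have h : ((c i : ℕ) : ℝ) < K := by exact_mod_cast (c i).2
    have : X c i < 1 - θ := by
      simp only [X]
      rw [div_lt_iff₀ hKr]
      exact mul_lt_mul_of_pos_left h (by linarith)
    linarith
  let arc : ℝ → Set (AddCircle (1 : ℝ)) := fun x => (fun t : ℝ => (t : AddCircle (1 : ℝ))) '' Set.Icc x (x + θ)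
  let w : (Fin n → Fin K) → Fin n → AddCircle (1 : ℝ) := fun c i => (X c i : AddCircle (1 : ℝ))
  let D : (Fin n → Fin K) → Set (Fin n → AddCircle (1 : ℝ)) := fun c =>
    Set.univ.pi fun i => arc (X c i)
  have mD : ∀ c, MeasurableSet (D c) := fun c =>
    MeasurableSet.univ_pi fun i =>
      (isCompact_Icc.image (AddCircle.continuous_mk' 1)).isClosed.measurableSet
  have hp : 0 < θ ^ n := by positivity
  have good : ∀ c, arcProb θ (w c) (D c) = 1 := by
    intro c
    have : ((fun t : Fin n → ℝ => fun i => w c i + (t i : AddCircle (1 : ℝ))) ⁻¹' (D c))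
      ∩ (Set.univ.pi fun _ => Set.Icc (0 : ℝ) θ) = Set.univ.pi fun _ => Set.Icc (0 : ℝ) θ := by
      rw [Set.inter_eq_right]
      intro t ht i hi
      have := ht i hi
      exact ⟨X c i + t i, ⟨by linarith [this.1], by linarith [this.2]⟩, by simp [w]⟩
    unfold arcProb
    rw [arcOut_eq θ _ (mD c), this, volB θ hθ0 n, ENNReal.toReal_ofReal hp.le, div_self hp.ne']
  have bad : ∀ c ∈ S, ∀ d ∈ S, c ≠ d → arcProb θ (w c) (D d) ≤ l2 := by
    intro c hc d hd hcd
    have sub : ((fun t : Fin n → ℝ => fun i => w c i + (t i : AddCircle (1 : ℝ))) ⁻¹' (D d))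
      ∩ (Set.univ.pi fun _ => Set.Icc (0 : ℝ) θ) ⊆ Set.univ.pi fun i =>
        Set.Icc (max 0 (X d i - X c i)) (min θ (θ + (X d i - X c i))) := by
      intro t ht i hi
      have q := ht.2 i hi
      obtain ⟨z, hz, hze⟩ := ht.1 i hi
      have e : z = X c i + t i := by
        refine (AddCircle.coe_eq_coe_iff_of_mem_Ico (p := 1) (a := 0) ?_ ?_).1 (by simpa [w] using hze)
        · constructor <;> linarith [hz.1, hz.2, X0 d i, X1 d i]
        · constructor <;> linarith [q.1, q.2, X0 c i, X1 c i]
      subst e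
      simp only [Set.mem_Icc, max_le_iff, le_min_iff]
      refine ⟨⟨q.1, ?_⟩, q.2, ?_⟩ <;> linarith [hz.1, hz.2]
    have vol : volume (Set.univ.pi fun i =>
        Set.Icc (max 0 (X d i - X c i)) (min θ (θ + (X d i - X c i)))) ≤
        ENNReal.ofReal (∏ i, θ * Real.exp (-|X d i - X c i| / θ)) := by
      rw [volume_pi_pi, ENNReal.ofReal_prod_of_nonneg (fun i _ => by positivity)]
      refine Finset.prod_le_prod' fun i _ => ?_
      rw [Real.volume_Icc]
      apply ENNReal.ofReal_le_ofReal
      have a : θ * (-|X d i - X c i| / θ + 1) ≤ θ * Real.exp (-|X d i - X c i| / θ) := by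
        gcongr
        exact Real.add_one_le_exp _
      have b : θ * (-|X d i - X c i| / θ + 1) = θ - |X d i - X c i| := by field_simp; ring
      rw [b] at a
      refine le_trans ?_ a
      rcases abs_cases (X d i - X c i) with h | h
      · rw [max_eq_right h.2, min_eq_left (by linarith)]; linarith
      · rw [max_eq_left h.2.le, min_eq_right (by linarith)]; linarith
    have sum : (m + 1) * ((1 - θ) / K) ≤ ∑ i, |X d i - X c i| := by
      have h := hS d hd c hc hcd.symm
      have e : ∑ i, (if d i ≠ c i then (1 - θ) / K else 0) = hammingDist d c * ((1 - θ) / K) := by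
        rw [← Finset.sum_filter, Finset.sum_const, nsmul_eq_mul, hammingDist]
      have : ((m : ℝ) + 1) ≤ hammingDist d c := by exact_mod_cast h
      calc (m + 1) * ((1 - θ) / K) ≤ hammingDist d c * ((1 - θ) / K) := by
            apply mul_le_mul_of_nonneg_right this
            apply div_nonneg (by linarith) hKr.le
        _ = _ := e.symm
        _ ≤ _ := by
          refine Finset.sum_le_sum fun i _ => ?_
          split_ifs with hi
          · have e2 : X d i - X c i = (1 - θ) / K * (((d i : ℕ) : ℤ) - ((c i : ℕ) : ℤ) : ℤ) := by
              simp only [X]; push_cast; ring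
            rw [e2, abs_mul, abs_of_nonneg (div_nonneg (by linarith) hKr.le)]
            apply le_mul_of_one_le_right (div_nonneg (by linarith) hKr.le)
            rw [← Int.cast_abs]
            have : (1 : ℤ) ≤ |((d i : ℕ) : ℤ) - ((c i : ℕ) : ℤ)| := by
              apply Int.one_le_abs
              intro h0
              apply hi
              apply Fin.ext
              omega
            exact_mod_cast this
          · positivity
    unfold arcProb
    rw [arcOut_eq θ _ (mD d), div_le_iff₀ hp]
    have := ENNReal.toReal_mono ENNReal.ofReal_ne_top ((measure_mono sub).trans vol)
    refine this.trans ?_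
    rw [ENNReal.toReal_ofReal (Finset.prod_nonneg fun i _ => by positivity), Finset.prod_mul_distrib,
      ← Real.exp_sum, Finset.prod_const, Finset.card_univ, Fintype.card_fin, mul_comm]
    gcongr
    rw [← Real.le_log_iff_exp_le h2, ← Finset.sum_div, Finset.sum_neg_distrib, div_le_iff₀ hθ0]
    rw [one_div, Real.log_inv] at hm
    have hm2 : θ * (-Real.log l2) ≤ (m + 1) * ((1 - θ) / K) := by
      rw [mul_div_assoc', le_div_iff₀ hKr]; exact hm
    linarith
  let e := S.equivFin.symm
  refine ⟨fun j => w (e j), fun j => D (e j), fun j => mD _, fun j => ?_, fun j k hjk => ?_⟩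
  · rw [good]; linarith
  · exact bad _ (e j).2 _ (e k).2 fun h => hjk (e.injective (Subtype.ext h))

lemma log_inv_tendsto (c : ℝ) :
    Filter.Tendsto (fun n : ℕ => c / Real.log n) Filter.atTop (nhds 0) :=
  Filter.Tendsto.const_div_atTop (Real.tendsto_log_atTop.comp tendsto_natCast_atTop_atTop) c

/-- Theorem (exact superexponential DI capacity of the arc channel `A^{(θ)}`): for every
`0 < θ < 1` and `λ₁,λ₂ > 0` with `λ₁+λ₂ < 1`, the maximal DI code sizes `N n` satisfy
`lim_{n→∞} log₂ N(n)/(n log₂ n) = 1`. -/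
theorem stmt17 (θ : ℝ) (hθ0 : 0 < θ) (hθ1 : θ < 1)
    (l1 l2 : ℝ) (h1 : 0 < l1) (h2 : 0 < l2) (h12 : l1 + l2 < 1)
    (N : ℕ → ℕ) (hN : ∀ n, IsGreatest {m : ℕ | arcCode θ n m l1 l2} (N n)) :
    Filter.Tendsto (fun n : ℕ =>
      Real.logb 2 (N n) / ((n : ℝ) * Real.logb 2 n)) Filter.atTop (nhds 1) := by
  have hl2 : l2 < 1 := by linarith
  have hratio : ∀ n : ℕ, Real.logb 2 (N n) / ((n : ℝ) * Real.logb 2 n)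
      = Real.log (N n) / (n * Real.log n) := by
    intro n
    have : Real.log 2 ≠ 0 := (Real.log_pos (by norm_num)).ne'
    unfold Real.logb
    rw [mul_div_assoc', div_div_div_cancel_right₀ this]
  simp only [hratio]
  refine tendsto_order.2 ⟨fun a ha => ?_, fun a ha => ?_⟩
  · obtain ⟨ε, hε0, hε1, hεa⟩ : ∃ ε : ℝ, 0 < ε ∧ ε < 1 ∧ a < 1 - ε :=
      ⟨min ((1 - a) / 2) (1 / 2), lt_min (by linarith) (by norm_num),
        (min_le_right _ _).trans_lt (by norm_num),
        by linarith [min_le_left ((1 - a) / 2) (1 / 2)]⟩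
    have hL : 0 < Real.log (1 / l2) := Real.log_pos (by rw [lt_div_iff₀ h2]; linarith)
    set L := Real.log (1 / l2) with hLdef
    set A := ε * ((1 - θ) / (θ * L)) with hA
    have hA0 : 0 < A := mul_pos hε0 (div_pos (by linarith) (by positivity))
    set β := A / 2 with hβ
    have hβ0 : 0 < β := by positivity
    have lim : Filter.Tendsto (fun n : ℕ => (1 - ε) * (1 + Real.log β / Real.log n)
        - Real.log 2 / Real.log n) Filter.atTop (nhds ((1 - ε) * (1 + 0) - 0)) :=
      (((log_inv_tendsto _).const_add 1).const_mul _).sub (log_inv_tendsto _)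
    have ev := (tendsto_order.1 lim).1 a (by linarith)
    filter_upwards [ev, Filter.eventually_ge_atTop 2,
      tendsto_natCast_atTop_atTop.eventually_ge_atTop (2 / A)] with n hn hn2 hnA
    refine hn.trans_le ?_
    have hn2' : (2 : ℝ) ≤ n := by exact_mod_cast hn2
    have hnpos : (0 : ℝ) < n := by linarith
    have hlogn : 0 < Real.log n := Real.log_pos (by linarith)
    have hAn : 2 ≤ A * n := by
      rw [div_le_iff₀ hA0] at hnA; linarith
    set K := ⌊A * n⌋₊ with hKdef
    set m := ⌊ε * n⌋₊ with hmdef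
    have hK1 : 1 ≤ K := Nat.le_floor (by push_cast; linarith)
    have hKle : (K : ℝ) ≤ A * n := Nat.floor_le (by positivity)
    have hKge : β * n ≤ K := by
      have := Nat.lt_floor_add_one (A * n)
      rw [hβ]; linarith
    have hmle : (m : ℝ) ≤ ε * n := Nat.floor_le (by positivity)
    have hmge : ε * n ≤ m + 1 := (Nat.lt_floor_add_one (ε * n)).le
    obtain ⟨S, hS, hcard⟩ := gv n K m hK1
    have hcode := lower_code θ hθ0 hθ1 l1 l2 h1 h2 n K m hK1 S hS (by
      calc θ * L * K ≤ θ * L * (A * n) := by gcongr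
        _ = (ε * n) * (1 - θ) := by rw [hA]; field_simp
        _ ≤ (m + 1) * (1 - θ) := by
          apply mul_le_mul_of_nonneg_right hmge (by linarith))
    have hSN : S.card ≤ N n := (hN n).2 hcode
    have hc2 : (K : ℝ) ^ n ≤ N n * (2 ^ n * K ^ m) := by
      have := hcard.trans (Nat.mul_le_mul_right (2 ^ n * K ^ m) hSN)
      exact_mod_cast this
    have hKpos : (0 : ℝ) < K := by exact_mod_cast hK1
    have hNpos : (0 : ℝ) < N n := by
      rcases Nat.eq_zero_or_pos (N n) with h | h
      · rw [h] at hc2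
        have : 0 < (K : ℝ) ^ n := by positivity
        simp at hc2
        linarith
      · exact_mod_cast h
    have hlog := Real.log_le_log (by positivity) hc2
    rw [Real.log_mul hNpos.ne' (by positivity), Real.log_mul (by positivity) (by positivity),
      Real.log_pow, Real.log_pow, Real.log_pow] at hlog
    have hlogK0 : 0 ≤ Real.log K := Real.log_nonneg (by exact_mod_cast hK1)
    have hlogK : Real.log β + Real.log n ≤ Real.log K := by
      rw [← Real.log_mul hβ0.ne' hnpos.ne']
      exact Real.log_le_log (by positivity) hKge
    have f1 : (m : ℝ) * Real.log K ≤ ε * n * Real.log K := by gcongr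
    have f2 : (1 - ε) * n * (Real.log β + Real.log n) ≤ (1 - ε) * n * Real.log K := by
      apply mul_le_mul_of_nonneg_left hlogK
      apply mul_nonneg (by linarith) hnpos.le
    rw [le_div_iff₀ (by positivity)]
    have e : ((1 - ε) * (1 + Real.log β / Real.log n) - Real.log 2 / Real.log n) * (n * Real.log n)
        = (1 - ε) * n * (Real.log β + Real.log n) - n * Real.log 2 := by
      field_simp
      ring
    rw [e]
    linarith
  · obtain ⟨γ, hγ0, hγ1, hγl⟩ : ∃ γ : ℝ, 0 < γ ∧ γ < 1 ∧ l2 + γ < 1 - l1 :=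
      ⟨(1 - l1 - l2) / 2, by linarith, by linarith, by linarith⟩
    set b := 1 / (θ * γ) + 1 with hb
    have hb0 : 0 < b := by positivity
    have hb1 : 1 ≤ b := by
      have : 0 < 1 / (θ * γ) := by positivity
      linarith
    have lim : Filter.Tendsto (fun n : ℕ => 1 + Real.log b / Real.log n) Filter.atTop
        (nhds (1 + 0)) := (log_inv_tendsto _).const_add 1
    have ev := (tendsto_order.1 lim).2 a (by linarith)
    filter_upwards [ev, Filter.eventually_ge_atTop 2] with n hn hn2
    refine lt_of_le_of_lt ?_ hn
    have hn2' : (2 : ℝ) ≤ n := by exact_mod_cast hn2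
    have hnpos : (0 : ℝ) < n := by linarith
    have hlogn : 0 < Real.log n := Real.log_pos (by linarith)
    have hle := upper_card θ hθ0 l1 l2 γ hγ0 hγ1 hγl (hN n).1 ⌈n / (θ * γ)⌉₊
      (Nat.ceil_pos.2 (by positivity)) (Nat.le_ceil _)
    have hK : (⌈n / (θ * γ)⌉₊ : ℝ) ≤ b * n := by
      have := Nat.ceil_lt_add_one (a := n / (θ * γ)) (by positivity)
      have e : b * n = n / (θ * γ) + n := by rw [hb]; ring
      linarith
    have hle' : (N n : ℝ) ≤ (b * n) ^ n := by
      calc (N n : ℝ) ≤ (⌈n / (θ * γ)⌉₊ : ℝ) ^ n := by exact_mod_cast hle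
        _ ≤ _ := by gcongr
    have hlogN : Real.log (N n) ≤ n * (Real.log b + Real.log n) := by
      rcases Nat.eq_zero_or_pos (N n) with h | h
      · rw [h]
        simp only [Nat.cast_zero, Real.log_zero]
        have := Real.log_nonneg hb1
        positivity
      · have := Real.log_le_log (by exact_mod_cast h) hle'
        rwa [Real.log_pow, Real.log_mul hb0.ne' hnpos.ne'] at this
    rw [div_le_iff₀ (by positivity)]
    refine hlogN.trans_eq ?_
    field_simp
    ring
end
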